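/- For every positive integer n and every integer e with 0 ≤ e ≤ 3n and e ≡ 0 (mod 3), there exists a PICS_2^e((2n)^3 : 0). -/

import Mathlib

namespace DataPlacement

open Finset

variable {α : Type*} [DecidableEq α]

/-- Number of blocks of the family `F` (with multiplicity) containing `T`. -/
def lamF (F : Multiset (Finset α)) (T : Finset α) : ℕ :=
  Multiset.card (F.filter fun B => T ⊆ B)

/-- Triple system with `b` blocks on a point set `X` of size `v`. -/
def IsTSOn (X : Finset α) (v b : ℕ) (F : Multiset (Finset α)) : Prop :=
  X.card = v ∧ Multiset.card F = b ∧ ∀ B ∈ F, B.card = 3 ∧ B ⊆ X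

/-- `(l, e)` is the pair associated with `(v, b)`:
`3b = l·v(v−1)/2 + e` with `−v/2 < e < v/2`. -/
def AssocPair (v b l : ℕ) (e : ℤ) : Prop :=
  6 * (b : ℤ) = (l : ℤ) * v * ((v : ℤ) - 1) + 2 * e ∧
    -(v : ℤ) < 2 * e ∧ 2 * e < (v : ℤ)

/-- Condition (C1). -/
def CondC1 (v b : ℕ) : Prop :=
  v % 3 = 2 ∧ ∃ l : ℕ, 0 < l ∧
    ((v % 6 = 5 ∧ (l % 3 = 1 ∨ l % 3 = 2)) ∨
     (v % 6 = 2 ∧ (l % 6 = 2 ∨ l % 6 = 4))) ∧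
    (b = l * v * (v - 1) / 6 ∨ b = (l * v * (v - 1) + 5) / 6)

/-- Condition (C2). -/
def CondC2 (v b : ℕ) : Prop :=
  v % 2 = 0 ∧ ∃ l : ℕ, 0 < l ∧ l % 2 = 1 ∧
    (l : ℤ) * v * ((v : ℤ) - 1) - v < 6 * (b : ℤ) ∧
    6 * (b : ℤ) < (l : ℤ) * v * ((v : ℤ) - 1) + v

/-- Pairs of points of `X` whose block count equals `l + i`. -/
def Dlev (X : Finset α) (F : Multiset (Finset α)) (l : ℕ) (i : ℤ) :
    Finset (Finset α) :=
  (X.powersetCard 2).filter fun p => (lamF F p : ℤ) = (l : ℤ) + i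

/-- Every pair of points of `X` lies in `l−1`, `l`, or `l+1` blocks. -/
def PairRangeOn (X : Finset α) (F : Multiset (Finset α)) (l : ℕ) : Prop :=
  ∀ p ∈ X.powersetCard 2,
    (l : ℤ) - 1 ≤ (lamF F p : ℤ) ∧ (lamF F p : ℤ) ≤ (l : ℤ) + 1

def IsTriangle (D : Finset (Finset α)) : Prop :=
  ∃ x y z : α, x ≠ y ∧ x ≠ z ∧ y ≠ z ∧
    D = {({x, y} : Finset α), {y, z}, {x, z}}

def IsFourCycle (D : Finset (Finset α)) : Prop :=
  ∃ x y z w : α, x ≠ y ∧ x ≠ z ∧ x ≠ w ∧ y ≠ z ∧ y ≠ w ∧ z ≠ w ∧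
    D = {({x, y} : Finset α), {y, z}, {z, w}, {x, w}}

/-- `D` is a perfect matching on the point set `X`. -/
def IsPerfectMatchingOn (X : Finset α) (D : Finset (Finset α)) : Prop :=
  (∀ p ∈ D, p.card = 2 ∧ p ⊆ X) ∧ ∀ x ∈ X, ∃! p, p ∈ D ∧ x ∈ p

/-- Defect-graph shape required for nearly 2-balance under (C1). -/
def C1ShapeOn (X : Finset α) (F : Multiset (Finset α)) (l : ℕ) (e : ℤ) : Prop :=
  (e = 1 ∧ IsTriangle (Dlev X F l 1 ∪ Dlev X F l (-1)) ∧
     (Dlev X F l 1).card = 2 ∧ (Dlev X F l (-1)).card = 1) ∨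
  (e = -1 ∧ IsTriangle (Dlev X F l 1 ∪ Dlev X F l (-1)) ∧
     (Dlev X F l 1).card = 1 ∧ (Dlev X F l (-1)).card = 2) ∨
  (e = 2 ∧ IsFourCycle (Dlev X F l 1 ∪ Dlev X F l (-1)) ∧
     (Dlev X F l 1).card = 3 ∧ (Dlev X F l (-1)).card = 1) ∨
  (e = -2 ∧ IsFourCycle (Dlev X F l 1 ∪ Dlev X F l (-1)) ∧
     (Dlev X F l 1).card = 1 ∧ (Dlev X F l (-1)).card = 3)

/-- Defect-graph shape required for nearly 2-balance under (C2)
(here `v = X.card`). -/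
def C2ShapeOn (X : Finset α) (v : ℕ) (F : Multiset (Finset α)) (l : ℕ) (e : ℤ) : Prop :=
  (((v : ℤ) - 2 * e) % 4 = 0 ∧
    IsPerfectMatchingOn X (Dlev X F l 1 ∪ Dlev X F l (-1)) ∧
    4 * ((Dlev X F l 1).card : ℤ) = (v : ℤ) + 2 * e ∧
    4 * ((Dlev X F l (-1)).card : ℤ) = (v : ℤ) - 2 * e) ∨
  (((v : ℤ) - 2 * e) % 4 ≠ 0 ∧
    ∃ (c a₂ a₃ a₄ : α) (star : Finset (Finset α)),
      c ∈ X ∧ a₂ ∈ X ∧ a₃ ∈ X ∧ a₄ ∈ X ∧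
      c ≠ a₂ ∧ c ≠ a₃ ∧ c ≠ a₄ ∧ a₂ ≠ a₃ ∧ a₂ ≠ a₄ ∧ a₃ ≠ a₄ ∧
      star = {({c, a₂} : Finset α), {c, a₃}, {c, a₄}} ∧
      star ⊆ Dlev X F l 1 ∪ Dlev X F l (-1) ∧
      IsPerfectMatchingOn (X \ {c, a₂, a₃, a₄})
        ((Dlev X F l 1 ∪ Dlev X F l (-1)) \ star) ∧
      (((star ∩ Dlev X F l 1).card = 2 ∧ (star ∩ Dlev X F l (-1)).card = 1 ∧
          4 * (((Dlev X F l 1) \ star).card : ℤ) = (v : ℤ) - 6 + 2 * e ∧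
          4 * (((Dlev X F l (-1)) \ star).card : ℤ) = (v : ℤ) - 2 - 2 * e) ∨
        ((star ∩ Dlev X F l 1).card = 1 ∧ (star ∩ Dlev X F l (-1)).card = 2 ∧
          4 * (((Dlev X F l 1) \ star).card : ℤ) = (v : ℤ) - 2 + 2 * e ∧
          4 * (((Dlev X F l (-1)) \ star).card : ℤ) = (v : ℤ) - 6 - 2 * e)))

/-- `F` is 3-balanced on `X`: the multiplicities of any two triples of `X`
differ by at most one. -/
def ThreeBalancedOn (X : Finset α) (F : Multiset (Finset α)) : Prop :=
  ∀ T₁ ∈ X.powersetCard 3, ∀ T₂ ∈ X.powersetCard 3, F.count T₁ ≤ F.count T₂ + 1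

/-- Nearly well-balanced triple system NWBTS(v;b) on the point set `X`. -/
def IsNWBTSOn (X : Finset α) (v b : ℕ) (F : Multiset (Finset α)) : Prop :=
  IsTSOn X v b F ∧ ThreeBalancedOn X F ∧
  ∃ (l : ℕ) (e : ℤ), 0 < l ∧ AssocPair v b l e ∧ PairRangeOn X F l ∧
    ((CondC1 v b ∧ C1ShapeOn X F l e) ∨ (CondC2 v b ∧ C2ShapeOn X v F l e))

/-- `B` is an S_mu(2,3,·) design on the point set `X`. -/
def IsSDesignOn (X : Finset α) (mu : ℕ) (B : Multiset (Finset α)) : Prop :=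
  (∀ A ∈ B, A.card = 3 ∧ A ⊆ X) ∧ ∀ p ∈ X.powersetCard 2, lamF B p = mu

/-- `B` is a GDD_mu(2,3,·) of type `1^{·}u^1` on `X` with long group `U`. -/
def IsGDD1u (X : Finset α) (mu u : ℕ) (U : Finset α) (B : Multiset (Finset α)) : Prop :=
  U ⊆ X ∧ U.card = u ∧
  (∀ A ∈ B, A.card = 3 ∧ A ⊆ X ∧ (A ∩ U).card ≤ 1) ∧
  ∀ p ∈ X.powersetCard 2, ¬ p ⊆ U → lamF B p = mu

/-- `B` is a GDD_mu(2,3,·) with group family `G`. -/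
def IsGDDgroups (mu : ℕ) {n : ℕ} (G : Fin n → Finset α) (B : Multiset (Finset α)) : Prop :=
  (∀ A ∈ B, A.card = 3 ∧ A ⊆ Finset.univ.biUnion G ∧ ∀ i, (A ∩ G i).card ≤ 1) ∧
  ∀ x y : α, x ≠ y → (∃ i j, i ≠ j ∧ x ∈ G i ∧ y ∈ G j) → lamF B {x, y} = mu

/-- Nearly group divisible design NGDD(2,3,·) of type `2^{(m,n)}u^1` on `X`. -/
def IsNGDD (X : Finset α) (m n u : ℕ) (G : Fin (m + n) → Finset α) (U : Finset α)
    (B : Multiset (Finset α)) : Prop :=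
  (∀ i, (G i).card = 2 ∧ G i ⊆ X) ∧ U.card = u ∧ U ⊆ X ∧
  (∀ i j, i ≠ j → Disjoint (G i) (G j)) ∧ (∀ i, Disjoint (G i) U) ∧
  U ∪ Finset.univ.biUnion G = X ∧
  (∀ A ∈ B, A.card = 3 ∧ A ⊆ X) ∧
  (∀ i : Fin (m + n), (i : ℕ) < m → lamF B (G i) = 2) ∧
  (∀ i : Fin (m + n), m ≤ (i : ℕ) → lamF B (G i) = 0) ∧
  (∀ p ∈ U.powersetCard 2, lamF B p = 0) ∧
  (∀ p ∈ X.powersetCard 2, (∀ i, ¬ p ⊆ G i) → ¬ p ⊆ U → lamF B p = 1)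

/-- Candelabra system CS(g^n : s) on `X` with stem `S` and groups `G`. -/
def IsCS (X : Finset α) (g n s : ℕ) (S : Finset α) (G : Fin n → Finset α)
    (A : Multiset (Finset α)) : Prop :=
  S.card = s ∧ S ⊆ X ∧ (∀ i, (G i).card = g ∧ G i ⊆ X) ∧
  (∀ i j, i ≠ j → Disjoint (G i) (G j)) ∧ (∀ i, Disjoint (G i) S) ∧
  S ∪ Finset.univ.biUnion G = X ∧
  (∀ B ∈ A, B.card = 3 ∧ B ⊆ X) ∧
  (∀ T ∈ X.powersetCard 3, (∀ i, ¬ T ⊆ S ∪ G i) → lamF A T = 1) ∧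
  (∀ T ∈ X.powersetCard 3, (∃ i, T ⊆ S ∪ G i) → lamF A T = 0)

/-- Partitionable candelabra system PCS(g^n : s). -/
def IsPCS (X : Finset α) (g n s : ℕ) (S : Finset α) (G : Fin n → Finset α)
    (A : Multiset (Finset α)) : Prop :=
  IsCS X g n s S G A ∧
  ∃ (Ax : α → Multiset (Finset α)) (Ai : Fin (s - 2) → Multiset (Finset α)),
    A = (∑ p ∈ X \ S, Ax p) + ∑ i, Ai i ∧
    (∀ i : Fin n, ∀ p ∈ G i, IsGDD1u X 1 (g + s) (G i ∪ S) (Ax p)) ∧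
    (∀ j, IsGDDgroups 1 G (Ai j))

/-- g-PCS_2((2ag)^n : s). -/
def IsGPCS2 (X : Finset α) (a g n s : ℕ) (S : Finset α) (G : Fin n → Finset α)
    (A : Multiset (Finset α)) : Prop :=
  IsCS X (2 * a * g) n s S G A ∧
  ∃ (P : Fin (g * n) → Multiset (Finset α)) (grp : Fin (g * n) → Fin n),
    (∑ i, P i) ≤ A ∧
    (∀ j : Fin n, (Finset.univ.filter fun i => grp i = j).card = g) ∧
    (∀ i, IsGDD1u X 2 (2 * a * g + s) (G (grp i) ∪ S) (P i))

/-- g-PCS_2^r((2ag)^n : s). -/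
def IsGPCS2r (X : Finset α) (a g n s r : ℕ) (S : Finset α) (G : Fin n → Finset α)
    (A : Multiset (Finset α)) : Prop :=
  IsCS X (2 * a * g) n s S G A ∧
  ∃ (P : Fin (g * n) → Multiset (Finset α)) (grp : Fin (g * n) → Fin n),
    (∑ i, P i) ≤ A ∧
    (∀ j : Fin n, (Finset.univ.filter fun i => grp i = j).card = g) ∧
    (∀ i, IsGDD1u X 2 (2 * a * g + s) (G (grp i) ∪ S) (P i)) ∧
    ∃ (i : Fin (g * n)) (N : Multiset (Finset α))
      (Gs : Fin (r + (a * g * (n - 1) - r)) → Finset α),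
      N ≤ P i ∧ IsNGDD X r (a * g * (n - 1) - r) (2 * a * g + s) Gs (G (grp i) ∪ S) N

/-- GDD(3,3,·) of type `g^k` on `X` with groups `H`. -/
def IsGDD3On (X : Finset α) (g : ℕ) {k : ℕ} (H : Fin k → Finset α)
    (A : Multiset (Finset α)) : Prop :=
  (∀ i, (H i).card = g ∧ H i ⊆ X) ∧ (∀ i j, i ≠ j → Disjoint (H i) (H j)) ∧
  Finset.univ.biUnion H = X ∧
  (∀ B ∈ A, B.card = 3 ∧ B ⊆ X ∧ ∀ i, (B ∩ H i).card ≤ 1) ∧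
  (∀ T ∈ X.powersetCard 3, (∀ i, (T ∩ H i).card ≤ 1) → lamF A T = 1)

/-- `B` is a GDD_mu(2,3,·) on the points not in the omitted group `H o`,
with group set `{H i : i ≠ o}`. -/
def IsGDDOmit (mu : ℕ) {k : ℕ} (H : Fin k → Finset α) (o : Fin k)
    (B : Multiset (Finset α)) : Prop :=
  (∀ A ∈ B, A.card = 3 ∧ Disjoint A (H o) ∧ ∀ i, (A ∩ H i).card ≤ 1) ∧
  ∀ x y : α, x ≠ y →
    (∃ i j, i ≠ j ∧ i ≠ o ∧ j ≠ o ∧ x ∈ H i ∧ y ∈ H j) → lamF B {x, y} = mu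

/-- PGDD_2((2g)^{n+1}). -/
def IsPGDD2 (g n : ℕ) (H : Fin (n + 1) → Finset (Fin (2 * g * (n + 1))))
    (A : Multiset (Finset (Fin (2 * g * (n + 1))))) : Prop :=
  IsGDD3On Finset.univ (2 * g) H A ∧
  ∃ (i0 : Fin (n + 1))
    (P : Fin (g * n + 2 * g) → Multiset (Finset (Fin (2 * g * (n + 1)))))
    (f : Fin (g * n + 2 * g) → Fin (n + 1)),
    A = ∑ i, P i ∧
    (∀ j, j ≠ i0 → (Finset.univ.filter fun i => f i = j).card = g) ∧
    (∀ i, f i ≠ i0 → IsGDDOmit 2 H (f i) (P i)) ∧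
    (∀ i, f i = i0 → IsGDDOmit 1 H i0 (P i))

/-- 1-FG(3,(K1,KT),n) of type 1^n. -/
def Is1FG (n : ℕ) (K1 KT : Set ℕ) (A1 AT : Multiset (Finset (Fin n))) : Prop :=
  (∀ B ∈ A1, B.card ∈ K1) ∧ (∀ B ∈ AT, B.card ∈ KT) ∧
  (∀ p ∈ (Finset.univ : Finset (Fin n)).powersetCard 2, lamF A1 p = 1) ∧
  (∀ T ∈ (Finset.univ : Finset (Fin n)).powersetCard 3, lamF (A1 + AT) T = 1)

/-- PICS_2^r((2g)^3 : 0). -/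
def IsPICS2 (g r : ℕ) (G : Fin 3 → Finset (Fin (6 * g)))
    (A : Multiset (Finset (Fin (6 * g)))) : Prop :=
  IsCS Finset.univ (2 * g) 3 0 (∅ : Finset (Fin (6 * g))) G A ∧
  ∃ P : Fin (4 * g - 2) → Multiset (Finset (Fin (6 * g))),
    A = ∑ i, P i ∧
    (∀ i : Fin (4 * g - 2), (i : ℕ) < 2 * g → IsSDesignOn Finset.univ 2 (P i)) ∧
    (∃ i : Fin (4 * g - 2), (i : ℕ) < 2 * g ∧
      ∃ (N : Multiset (Finset (Fin (6 * g))))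
        (Gs : Fin (r + (3 * g - r)) → Finset (Fin (6 * g))),
        N ≤ P i ∧ IsNGDD Finset.univ r (3 * g - r) 0 Gs ∅ N) ∧
    (∀ i : Fin (4 * g - 2), 2 * g ≤ (i : ℕ) → IsGDDgroups 1 G (P i))

/-- Number of ordered pairs of blocks of `F` whose intersection has exactly
`j` points. -/
def interCount (F : Multiset (Finset α)) (j : ℕ) : ℕ :=
  Multiset.card
    ((F.bind fun A => F.map fun B => (A, B)).filter fun p => (p.1 ∩ p.2).card = j)

/-- The polynomial `P(F, x) = Σ_{j=0}^{3} v_j x^j`. -/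
noncomputable def Pval (F : Multiset (Finset α)) (x : ℝ) : ℝ :=
  ∑ j ∈ Finset.range 4, (interCount F j : ℝ) * x ^ j

/-- Optimal data placement for triple replication. -/
def IsOptimalDP (v b : ℕ) (F : Multiset (Finset (Fin v))) : Prop :=
  IsTSOn Finset.univ v b F ∧
  ∀ F' : Multiset (Finset (Fin v)), IsTSOn Finset.univ v b F' →
    ∀ x : ℝ, 1 ≤ x → Pval F x ≤ Pval F' x

section Fam

variable {β : Type} [DecidableEq β] [Fintype β]

/-- A ternary relation invariant under all permutations of its arguments. -/
def SymRel (R : β → β → β → Prop) : Prop :=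
  (∀ u v w, R u v w → R v u w) ∧ (∀ u v w, R u v w → R u w v)

open Classical in
/-- The block family of a ternary relation. -/
noncomputable def fam (R : β → β → β → Prop) : Multiset (Finset β) :=
  ((Finset.univ : Finset (Finset β)).filter fun T =>
    ∃ u v w, u ≠ v ∧ u ≠ w ∧ v ≠ w ∧ R u v w ∧ T = {u, v, w}).val

theorem mem_fam {R : β → β → β → Prop} {T : Finset β} :
    T ∈ fam R ↔ ∃ u v w, u ≠ v ∧ u ≠ w ∧ v ≠ w ∧ R u v w ∧ T = {u, v, w} := by
  simp [fam]

theorem mem_fam_triple {R : β → β → β → Prop} (hR : SymRel R) {u v w : β}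
    (huv : u ≠ v) (huw : u ≠ w) (hvw : v ≠ w) :
    ({u, v, w} : Finset β) ∈ fam R ↔ R u v w := by
  rw [mem_fam]
  constructor
  · rintro ⟨a, b, c, hab, hac, hbc, h, e⟩
    obtain ⟨h1, h2⟩ := hR
    have hu : u ∈ ({a, b, c} : Finset β) := by rw [← e]; simp
    have hv : v ∈ ({a, b, c} : Finset β) := by rw [← e]; simp
    have hw : w ∈ ({a, b, c} : Finset β) := by rw [← e]; simp
    simp only [Finset.mem_insert, Finset.mem_singleton] at hu hv hw
    rcases hu with rfl | rfl | rfl <;> rcases hv with rfl | rfl | rfl <;>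
      rcases hw with rfl | rfl | rfl <;> first | (exfalso; tauto) | skip
    · exact h
    · exact h2 _ _ _ h
    · exact h1 _ _ _ h
    · exact h2 _ _ _ (h1 _ _ _ h)
    · exact h1 _ _ _ (h2 _ _ _ h)
    · exact h1 _ _ _ (h2 _ _ _ (h1 _ _ _ h))
  · intro h
    exact ⟨u, v, w, huv, huw, hvw, h, rfl⟩

theorem card_of_mem_fam {R : β → β → β → Prop} {T : Finset β} (h : T ∈ fam R) :
    T.card = 3 := by
  obtain ⟨u, v, w, huv, huw, hvw, -, rfl⟩ := mem_fam.1 h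
  exact Finset.card_eq_three.2 ⟨u, v, w, huv, huw, hvw, rfl⟩

theorem fam_mono {R R' : β → β → β → Prop} (h : ∀ u v w, R u v w → R' u v w) :
    fam R ≤ fam R' := by
  unfold fam
  rw [Finset.val_le_iff]
  intro T
  simp only [Finset.mem_filter, Finset.mem_univ, true_and]
  rintro ⟨u, v, w, a, b, c, d, e⟩
  exact ⟨u, v, w, a, b, c, h _ _ _ d, e⟩

open Classical in
theorem lamF_pair {R : β → β → β → Prop} (hR : SymRel R) {u v : β} (huv : u ≠ v) :
    lamF (fam R) {u, v} =
      (Finset.univ.filter fun w => w ≠ u ∧ w ≠ v ∧ R u v w).card := by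
  unfold lamF
  have : (Multiset.filter (fun B => ({u, v} : Finset β) ⊆ B) (fam R)) =
      ((Finset.univ : Finset (Finset β)).filter fun T =>
        T ∈ fam R ∧ {u, v} ⊆ T).val := by
    unfold fam
    rw [← Finset.filter_val, Finset.filter_filter]
    congr 1
    ext T
    simp
  rw [this, Finset.card_val]
  symm
  refine Finset.card_bij (fun w _ => {u, v, w}) ?_ ?_ ?_
  · intro w hw
    simp only [Finset.mem_filter, Finset.mem_univ, true_and] at hw ⊢
    refine ⟨(mem_fam_triple hR huv (Ne.symm hw.1) (Ne.symm hw.2.1)).2 hw.2.2, ?_⟩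
    intro x; simp; tauto
  · intro w hw w' hw' e
    simp only [Finset.mem_filter, Finset.mem_univ, true_and] at hw hw'
    have : w ∈ ({u, v, w'} : Finset β) := by rw [← e]; simp
    simp only [Finset.mem_insert, Finset.mem_singleton] at this
    tauto
  · intro T hT
    simp only [Finset.mem_filter, Finset.mem_univ, true_and] at hT
    obtain ⟨hT, hs⟩ := hT
    have h3 := card_of_mem_fam hT
    have h2 : ({u, v} : Finset β).card = 2 := Finset.card_pair huv
    obtain ⟨w, hw, hwT⟩ : ∃ w, w ∉ ({u, v} : Finset β) ∧ insert w {u, v} = T := by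
      have h1 : (T \ {u, v}).card = 1 := by
        rw [Finset.card_sdiff_of_subset hs]; omega
      obtain ⟨w, hw⟩ := Finset.card_eq_one.1 h1
      have hmem : w ∈ T \ {u, v} := by rw [hw]; simp
      refine ⟨w, (Finset.mem_sdiff.1 hmem).2, ?_⟩
      apply Finset.eq_of_subset_of_card_le
      · intro x hx
        rcases Finset.mem_insert.1 hx with rfl | hx
        · exact (Finset.mem_sdiff.1 hmem).1
        · exact hs hx
      · rw [Finset.card_insert_of_notMem (Finset.mem_sdiff.1 hmem).2]; omega
    simp only [Finset.mem_insert, Finset.mem_singleton, not_or] at hw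
    have hTe : T = {u, v, w} := by
      rw [← hwT]; ext x; simp; tauto
    refine ⟨w, ?_, hTe.symm⟩
    simp only [Finset.mem_filter, Finset.mem_univ, true_and]
    refine ⟨hw.1, hw.2, ?_⟩
    rw [hTe] at hT
    exact (mem_fam_triple hR huv (Ne.symm hw.1) (Ne.symm hw.2)).1 hT

open Classical in
theorem lamF_triple {R : β → β → β → Prop} {T : Finset β} (hT : T.card = 3) :
    lamF (fam R) T = if T ∈ fam R then 1 else 0 := by
  unfold lamF
  have : (Multiset.filter (fun B => T ⊆ B) (fam R)) =
      ((Finset.univ : Finset (Finset β)).filter fun B => B ∈ fam R ∧ B = T).val := by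
    unfold fam
    rw [← Finset.filter_val, Finset.filter_filter]
    congr 1
    ext B
    simp only [Finset.mem_filter, Finset.mem_univ, true_and, Finset.mem_val]
    constructor
    · rintro ⟨h, hs⟩
      refine ⟨h, ?_⟩
      have := card_of_mem_fam (mem_fam.2 h)
      exact (Finset.eq_of_subset_of_card_le hs (by omega)).symm
    · rintro ⟨h, rfl⟩
      exact ⟨h, Finset.Subset.refl _⟩
  rw [this, Finset.card_val]
  split_ifs with h
  · rw [Finset.card_eq_one]
    refine ⟨T, ?_⟩
    ext B
    simp only [Finset.mem_filter, Finset.mem_univ, true_and, Finset.mem_singleton]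
    constructor
    · exact fun h => h.2
    · rintro rfl; exact ⟨h, rfl⟩
  · rw [Finset.card_eq_zero]
    ext B
    simp only [Finset.mem_filter, Finset.mem_univ, true_and, Finset.notMem_empty, iff_false]
    rintro ⟨h', rfl⟩
    exact h h'

theorem lamF_sum {ι : Type} [Fintype ι] (P : ι → Multiset (Finset β)) (T : Finset β) :
    lamF (∑ i, P i) T = ∑ i, lamF (P i) T := by
  classical
  unfold lamF
  have : ∀ s : Finset ι, Multiset.card (Multiset.filter (fun B => T ⊆ B) (∑ i ∈ s, P i)) =
      ∑ i ∈ s, Multiset.card (Multiset.filter (fun B => T ⊆ B) (P i)) := by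
    intro s
    induction s using Finset.induction_on with
    | empty => simp
    | insert a s ha ih => rw [Finset.sum_insert ha, Finset.sum_insert ha, Multiset.filter_add,
        Multiset.card_add, ih]
  exact this _

end Fam

/-! ### The abstract system -/

/-- The points of one group. -/
abbrev Gp (n : ℕ) : Type := ZMod n × Bool

/-- All points. -/
abbrev Pt (n : ℕ) : Type := Fin 3 × Gp n

/-- The combinatorial data used in the construction. The classes of triple systems are
indexed by `ZMod n × Bool`; `C k i` gives the coordinates, in class `k`, of the
points of group `i`. -/
structure Sys (n : ℕ) where
  C : Gp n → Fin 3 → Gp n → Gp n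
  t : Gp n → Fin 3 → Gp n → Gp n
  M : Gp n → Gp n → Gp n
  Θ : Gp n → ZMod (2 * n)
  k0 : Gp n
  C_bij : ∀ k i, Function.Bijective (C k i)
  t_bij : ∀ k i, Function.Bijective (t k i)
  M_comm : ∀ a b, M a b = M b a
  M_bij : ∀ a, Function.Bijective (M a)
  M_diag : ∀ a, M a a = (a.1, false)
  t_diag : ∀ k i a, t k i (M (C k0 i a) (C k0 i a)) = ((C k i a).1, false)
  exu : ∀ i l m y, i ≠ l → ∃! k, C k l y = t k i m
  t0 : ∀ i m, t k0 i m = m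
  Θ_bij : Function.Bijective Θ
  tr1 : ∀ x y z, (Θ x + Θ y + Θ z = 0 ∨ Θ x + Θ y + Θ z = 1) → ∃! k,
    (C k 0 x).1 = (C k 1 y).1 ∧ (C k 0 x).1 = (C k 2 z).1 ∧
    ¬ ((C k 0 x).2 = true ∧ (C k 1 y).2 = true) ∧
    ¬ ((C k 0 x).2 = true ∧ (C k 2 z).2 = true) ∧
    ¬ ((C k 1 y).2 = true ∧ (C k 2 z).2 = true)
  tr2 : ∀ x y z k, 
    (C k 0 x).1 = (C k 1 y).1 → (C k 0 x).1 = (C k 2 z).1 →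
    ¬ ((C k 0 x).2 = true ∧ (C k 1 y).2 = true) →
    ¬ ((C k 0 x).2 = true ∧ (C k 2 z).2 = true) →
    ¬ ((C k 1 y).2 = true ∧ (C k 2 z).2 = true) →
    (Θ x + Θ y + Θ z = 0 ∨ Θ x + Θ y + Θ z = 1)
  hex : ∀ Q : ZMod n → Prop, ∃ h : Gp n → Gp n → Prop,
    (∀ a b, h a b → h b a) ∧ (∀ a b, h a (M a b) → h b (M a b)) ∧
    ∀ q, h (q, false) (q, true) ↔ Q q

namespace Sys

variable {n : ℕ} (S : Sys n)

/-- Class coordinates of a point. -/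
def c (k : Gp n) (u : Pt n) : Gp n := S.C k u.1 u.2

/-- Blocks with two points in one group. -/
def Two (k : Gp n) (φ : Pt n → Pt n → Prop) (u v w : Pt n) : Prop :=
  u.1 = v.1 ∧ w.1 ≠ u.1 ∧ S.c k w = S.t k u.1 (S.M (S.c S.k0 u) (S.c S.k0 v)) ∧ φ u w

/-- Transversal blocks. -/
def Tr (k : Gp n) (ψ : Bool → ZMod n → Prop) (u v w : Pt n) : Prop :=
  u.1 ≠ v.1 ∧ u.1 ≠ w.1 ∧ v.1 ≠ w.1 ∧ (S.c k u).1 = (S.c k v).1 ∧ (S.c k u).1 = (S.c k w).1 ∧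
  ¬ ((S.c k u).2 = true ∧ (S.c k v).2 = true) ∧ ¬ ((S.c k u).2 = true ∧ (S.c k w).2 = true) ∧
  ¬ ((S.c k v).2 = true ∧ (S.c k w).2 = true) ∧
  ψ (!(S.c k u).2 && !(S.c k v).2 && !(S.c k w).2) (S.c k u).1

/-- The block relation of one class, with a selection. -/
def Rel (k : Gp n) (φ : Pt n → Pt n → Prop) (ψ : Bool → ZMod n → Prop) (u v w : Pt n) : Prop :=
  S.Two k φ u v w ∨ S.Two k φ u w v ∨ S.Two k φ v w u ∨ S.Tr k ψ u v w

/-- The selection is compatible with the blocks. -/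
def Compat (k : Gp n) (φ : Pt n → Pt n → Prop) : Prop :=
  ∀ u v w, S.Two k φ u v w → φ v w

theorem two_symm {k : Gp n} {φ : Pt n → Pt n → Prop} (hφ : S.Compat k φ) {u v w : Pt n}
    (h : S.Two k φ u v w) : S.Two k φ v u w := by
  have h' := hφ _ _ _ h
  obtain ⟨h1, h2, h3, h4⟩ := h
  refine ⟨h1.symm, by rw [← h1]; exact h2, ?_, h'⟩
  rw [h3, h1, S.M_comm]

theorem rel_symm {k : Gp n} {φ : Pt n → Pt n → Prop} {ψ : Bool → ZMod n → Prop}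
    (hφ : S.Compat k φ) : SymRel (S.Rel k φ ψ) := by
  constructor
  · intro u v w h
    rcases h with h | h | h | h
    · exact Or.inl (S.two_symm hφ h)
    · exact Or.inr (Or.inr (Or.inl h))
    · exact Or.inr (Or.inl h)
    · refine Or.inr (Or.inr (Or.inr ?_))
      obtain ⟨h1, h2, h3, h4, h5, h6, h7, h8, h9⟩ := h
      refine ⟨h1.symm, h3, h2, h4.symm, h4 ▸ h5, by tauto, h8, h7, ?_⟩
      rw [← h4, Bool.and_comm (!(S.c k v).2)]
      exact h9
  · intro u v w h
    rcases h with h | h | h | h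
    · exact Or.inr (Or.inl h)
    · exact Or.inl h
    · exact Or.inr (Or.inr (Or.inl (S.two_symm hφ h)))
    · refine Or.inr (Or.inr (Or.inr ?_))
      obtain ⟨h1, h2, h3, h4, h5, h6, h7, h8, h9⟩ := h
      refine ⟨h2, h1, h3.symm, h5, h4, h7, h6, by tauto, ?_⟩
      rw [Bool.and_right_comm]
      exact h9

end Sys

section Count

theorem card_filter_one {γ : Type} [Fintype γ] {p : γ → Prop} [DecidablePred p] (h : ∃! x, p x) :
    (Finset.univ.filter p).card = 1 := by
  obtain ⟨x, hx, hu⟩ := h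
  rw [Finset.card_eq_one]
  refine ⟨x, ?_⟩
  ext y
  simp only [Finset.mem_filter, Finset.mem_univ, true_and, Finset.mem_singleton]
  exact ⟨hu y, fun e => e ▸ hx⟩

theorem card_filter_zero {γ : Type} [Fintype γ] {p : γ → Prop} [DecidablePred p] (h : ∀ x, ¬ p x) :
    (Finset.univ.filter p).card = 0 := by
  rw [Finset.card_eq_zero]
  ext y
  simp [h y]

theorem card_filter_bij {γ δ : Type} [Fintype γ] [Fintype δ] {f : γ → δ}
    (hf : Function.Bijective f) (p : δ → Prop) [DecidablePred p]
    [DecidablePred fun x => p (f x)] :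
    (Finset.univ.filter fun x => p (f x)).card = (Finset.univ.filter p).card := by
  refine Finset.card_bij (fun x _ => f x) ?_ ?_ ?_
  · intro a ha; simpa using ha
  · intro a _ b _ e; exact hf.1 e
  · intro b hb
    obtain ⟨a, rfl⟩ := hf.2 b
    exact ⟨a, by simpa using hb, rfl⟩

/-- If `f` is bijective and `y` is a point, the number of `b ≠ a` with `f b = y` (and a
side condition not depending on `b`). -/
theorem card_filter_ne {γ δ : Type} [Fintype γ] {f : γ → δ} (hf : Function.Bijective f)
    (a : γ) (y : δ) (q : Prop) [DecidablePred fun b => b ≠ a ∧ y = f b ∧ q]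
    [Decidable (y ≠ f a ∧ q)] :
    (Finset.univ.filter fun b => b ≠ a ∧ y = f b ∧ q).card = if y ≠ f a ∧ q then 1 else 0 := by
  split_ifs with h
  · apply card_filter_one
    obtain ⟨b, rfl⟩ := hf.2 y
    refine ⟨b, ⟨fun e => h.1 (by rw [e]), rfl, h.2⟩, ?_⟩
    rintro b' ⟨-, e, -⟩
    exact (hf.1 e).symm
  · apply card_filter_zero
    rintro b ⟨h1, rfl, h3⟩
    exact h ⟨fun e => h1 (hf.1 e), h3⟩

theorem sum_three {i k l : Fin 3} (h1 : i ≠ k) (h2 : i ≠ l) (h3 : k ≠ l) (f : Fin 3 → ℕ) :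
    ∑ j, f j = f i + f k + f l := by
  rw [Fin.sum_univ_three]
  fin_cases i <;> fin_cases k <;> fin_cases l <;> first | (exfalso; tauto) | (simp; try omega)

theorem card_filter_pt {n : ℕ} [NeZero n] (p : Pt n → Prop) [DecidablePred p] :
    (Finset.univ.filter p).card = ∑ j, (Finset.univ.filter fun g => p (j, g)).card := by
  rw [Finset.card_eq_sum_card_fiberwise (f := fun w : Pt n => w.1) (t := Finset.univ)
    (by intro x _; simp)]
  apply Finset.sum_congr rfl
  intro j _
  symm
  refine Finset.card_bij (fun g _ => (j, g)) ?_ ?_ ?_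
  · intro g hg; simpa using hg
  · intro a _ b _ e; simpa using e
  · rintro ⟨j', g⟩ hg
    simp only [Finset.mem_filter, Finset.mem_univ, true_and] at hg
    obtain ⟨hg, rfl⟩ := hg
    exact ⟨g, by simpa using hg, rfl⟩

/-- Number of points in a fibre satisfying a predicate. -/
theorem card_filter_fibre {n : ℕ} [NeZero n] (q : ZMod n) (p : Gp n → Prop) [DecidablePred p]
    (hp : ∀ g, p g → g.1 = q) :
    (Finset.univ.filter p).card =
      (if p (q, false) then 1 else 0) + (if p (q, true) then 1 else 0) := by
  have : (Finset.univ.filter p) =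
      (if p (q, false) then {(q, false)} else ∅) ∪ (if p (q, true) then {(q, true)} else ∅) := by
    ext ⟨j, b⟩
    simp only [Finset.mem_filter, Finset.mem_univ, true_and, Finset.mem_union]
    constructor
    · intro h
      have e : j = q := hp _ h
      subst e
      cases b
      · left; simp [h]
      · right; simp [h]
    · rintro (h | h)
      · split_ifs at h with h'
        · rw [Finset.mem_singleton.1 h]; exact h'
        · simp at h
      · split_ifs at h with h'
        · rw [Finset.mem_singleton.1 h]; exact h'
        · simp at h
  rw [this, Finset.card_union_of_disjoint]
  · split_ifs <;> simp
  · split_ifs <;> simp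

end Count

namespace Sys

variable {n : ℕ} [NeZero n] (S : Sys n)

open Classical in
/-- Number of blocks through a pair, on the level of points. -/
noncomputable def cnt (R : Pt n → Pt n → Pt n → Prop) (u v : Pt n) : ℕ :=
  (Finset.univ.filter fun w => w ≠ u ∧ w ≠ v ∧ R u v w).card

theorem third_exists (i k : Fin 3) (h : i ≠ k) : ∃ l, i ≠ l ∧ k ≠ l := by
  revert i k; decide

open Classical in
theorem cnt_same {k : Gp n} {φ : Pt n → Pt n → Prop} {ψ : Bool → ZMod n → Prop}
    {i : Fin 3} {a b : Gp n} (hab : a ≠ b) :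
    ∃ w : Fin 3 → Gp n, 
      (∀ j, S.C k j (w j) = S.t k i (S.M (S.C S.k0 i a) (S.C S.k0 i b))) ∧
      cnt (S.Rel k φ ψ) (i, a) (i, b) =
        (if φ (i, a) (i + 1, w (i + 1)) then 1 else 0) +
        (if φ (i, a) (i + 2, w (i + 2)) then 1 else 0) := by
  have hex := fun j => (S.C_bij k j).2 (S.t k i (S.M (S.C S.k0 i a) (S.C S.k0 i b)))
  choose w hw using hex
  refine ⟨w, hw, ?_⟩
  have e1 : i ≠ i + 1 := by clear * -; revert i; decide
  have e2 : i ≠ i + 2 := by clear * -; revert i; decide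
  have e3 : i + 1 ≠ i + 2 := by clear * -; revert i; decide
  unfold cnt
  rw [card_filter_pt, sum_three e1 e2 e3]
  have key : ∀ j, i ≠ j → (Finset.univ.filter fun g : Gp n =>
      ((j, g) : Pt n) ≠ (i, a) ∧ ((j, g) : Pt n) ≠ (i, b) ∧
        S.Rel k φ ψ (i, a) (i, b) (j, g)).card = if φ (i, a) (j, w j) then 1 else 0 := by
    intro j hj
    have hrel : ∀ g, S.Rel k φ ψ (i, a) (i, b) (j, g) ↔ g = w j ∧ φ (i, a) (j, g) := by
      intro g
      unfold Rel Two Tr c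
      simp only
      constructor
      · rintro (⟨-, -, h, h'⟩ | ⟨h, -⟩ | ⟨h, -⟩ | ⟨h, -⟩)
        · exact ⟨(S.C_bij k j).1 (h.trans (hw j).symm), h'⟩
        · exact absurd h hj
        · exact absurd h hj
        · exact absurd rfl h
      · rintro ⟨rfl, h⟩
        exact Or.inl ⟨by trivial, Ne.symm hj, hw j, h⟩
    split_ifs with h
    · apply card_filter_one
      refine ⟨w j, ⟨?_, ?_, (hrel _).2 ⟨rfl, h⟩⟩, ?_⟩
      · intro e; exact hj (Prod.ext_iff.1 e).1.symm
      · intro e; exact hj (Prod.ext_iff.1 e).1.symm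
      · rintro g ⟨-, -, h⟩; exact ((hrel g).1 h).1
    · apply card_filter_zero
      rintro g ⟨-, -, h'⟩
      obtain ⟨rfl, h2⟩ := (hrel g).1 h'
      exact h h2
  rw [key _ e1, key _ e2, card_filter_zero, zero_add]
  rintro g ⟨-, -, h⟩
  unfold Rel Two Tr at h
  simp at h

open Classical in
theorem cnt_cross {k : Gp n} {φ : Pt n → Pt n → Prop} {ψ : Bool → ZMod n → Prop}
    (hφ : S.Compat k φ) {u v : Pt n} (huv : u.1 ≠ v.1) :
    cnt (S.Rel k φ ψ) u v =
        (if S.c k v ≠ ((S.c k u).1, false) ∧ φ u v then 1 else 0) +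
        (if S.c k u ≠ ((S.c k v).1, false) ∧ φ v u then 1 else 0) +
        (if (S.c k u).1 = (S.c k v).1 then 
          (if ¬ ((S.c k u).2 = true ∧ (S.c k v).2 = true) ∧
            ψ (!(S.c k u).2 && !(S.c k v).2) (S.c k u).1 then 1 else 0) +
          (if ((S.c k u).2 = false ∧ (S.c k v).2 = false) ∧
            ψ false (S.c k u).1 then 1 else 0) else 0) := by
  obtain ⟨i, a⟩ := u
  obtain ⟨j, b⟩ := v
  simp only at huv
  obtain ⟨l, hl1, hl2⟩ := third_exists i j huv
  have hij : j ≠ i := huv.symm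
  unfold cnt
  rw [card_filter_pt, sum_three huv hl1 hl2]
  congr 1
  · congr 1
    · have hbij : Function.Bijective (fun g => S.t k i (S.M (S.C S.k0 i a) (S.C S.k0 i g))) :=
        (S.t_bij k i).comp ((S.M_bij _).comp (S.C_bij _ _))
      rw [show ((S.c k (i, a)).1, false) = S.t k i (S.M (S.C S.k0 i a) (S.C S.k0 i a)) from
        (S.t_diag k i a).symm]
      rw [← card_filter_ne hbij a (S.c k (j, b)) (φ (i, a) (j, b))]
      congr 1
      ext g
      simp only [Finset.mem_filter, Finset.mem_univ, true_and]
      constructor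
      · rintro ⟨h1, -, h⟩
        refine ⟨fun e => h1 (by rw [e]), ?_⟩
        rcases h with ⟨h, -⟩ | ⟨-, -, h, h'⟩ | ⟨h, -⟩ | ⟨-, h, -⟩
        · exact absurd h huv
        · exact ⟨h, h'⟩
        · exact absurd h hij
        · exact absurd rfl h
      · rintro ⟨h1, h2, h3⟩
        refine ⟨fun e => h1 (Prod.ext_iff.1 e).2, fun e => huv (Prod.ext_iff.1 e).1, ?_⟩
        exact Or.inr (Or.inl ⟨rfl, hij, h2, h3⟩)
    · have hbij : Function.Bijective (fun g => S.t k j (S.M (S.C S.k0 j b) (S.C S.k0 j g))) :=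
        (S.t_bij k j).comp ((S.M_bij _).comp (S.C_bij _ _))
      rw [show ((S.c k (j, b)).1, false) = S.t k j (S.M (S.C S.k0 j b) (S.C S.k0 j b)) from
        (S.t_diag k j b).symm]
      rw [← card_filter_ne hbij b (S.c k (i, a)) (φ (j, b) (i, a))]
      congr 1
      ext g
      simp only [Finset.mem_filter, Finset.mem_univ, true_and]
      constructor
      · rintro ⟨-, h1, h⟩
        refine ⟨fun e => h1 (by rw [e]), ?_⟩
        rcases h with ⟨h, -⟩ | ⟨h, -⟩ | ⟨-, -, h, h'⟩ | ⟨-, -, h, -⟩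
        · exact absurd h huv
        · exact absurd h huv
        · exact ⟨h, h'⟩
        · exact absurd rfl h
      · rintro ⟨h1, h2, h3⟩
        refine ⟨fun e => hij (Prod.ext_iff.1 e).1, fun e => h1 (Prod.ext_iff.1 e).2, ?_⟩
        exact Or.inr (Or.inr (Or.inl ⟨rfl, huv, h2, h3⟩))
  · have hrel : ∀ g, (((l, g) : Pt n) ≠ (i, a) ∧ ((l, g) : Pt n) ≠ (j, b) ∧
        S.Rel k φ ψ (i, a) (j, b) (l, g)) ↔ S.Tr k ψ (i, a) (j, b) (l, g) := by
      intro g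
      constructor
      · rintro ⟨-, -, ⟨h, -⟩ | ⟨h, -⟩ | ⟨h, -⟩ | h⟩
        · exact absurd h huv
        · exact absurd h hl1
        · exact absurd h hl2
        · exact h
      · intro h
        exact ⟨fun e => hl1 (Prod.ext_iff.1 e).1.symm, fun e => hl2 (Prod.ext_iff.1 e).1.symm,
          Or.inr (Or.inr (Or.inr h))⟩
    simp only [hrel]
    by_cases hq : (S.c k (i, a)).1 = (S.c k (j, b)).1
    · rw [if_pos hq]
      have h1 := card_filter_bij (S.C_bij k l) (fun g : Gp n =>
        (S.c k (i, a)).1 = g.1 ∧ ¬ ((S.c k (i, a)).2 = true ∧ (S.c k (j, b)).2 = true) ∧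
        ¬ ((S.c k (i, a)).2 = true ∧ g.2 = true) ∧
        ¬ ((S.c k (j, b)).2 = true ∧ g.2 = true) ∧
        ψ (!(S.c k (i, a)).2 && !(S.c k (j, b)).2 && !g.2) (S.c k (i, a)).1)
      have h2 := card_filter_fibre (S.c k (i, a)).1 (fun g : Gp n =>
        (S.c k (i, a)).1 = g.1 ∧ ¬ ((S.c k (i, a)).2 = true ∧ (S.c k (j, b)).2 = true) ∧
        ¬ ((S.c k (i, a)).2 = true ∧ g.2 = true) ∧
        ¬ ((S.c k (j, b)).2 = true ∧ g.2 = true) ∧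
        ψ (!(S.c k (i, a)).2 && !(S.c k (j, b)).2 && !g.2) (S.c k (i, a)).1)
        (fun g hg => hg.1.symm)
      refine Eq.trans ?_ (h1.trans (h2.trans ?_))
      · congr 1
        ext g
        simp only [Finset.mem_filter, Finset.mem_univ, true_and]
        unfold Tr
        exact ⟨fun h => ⟨h.2.2.2.2.1, h.2.2.2.2.2⟩, fun h => ⟨huv, hl1, hl2, hq, h.1, h.2⟩⟩
      · cases (S.c k (i, a)).2 <;> cases (S.c k (j, b)).2 <;> simp
    · rw [if_neg hq]
      apply card_filter_zero
      intro g h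
      exact hq h.2.2.2.1

end Sys

/-! ### Pair counts -/

namespace Sys

variable {n : ℕ} [NeZero n] (S : Sys n)

theorem cnt_comm {R : Pt n → Pt n → Pt n → Prop} (hR : SymRel R) (u v : Pt n) :
    cnt R u v = cnt R v u := by
  classical
  unfold cnt
  congr 1
  ext w
  simp only [Finset.mem_filter, Finset.mem_univ, true_and]
  constructor
  · rintro ⟨h1, h2, h3⟩; exact ⟨h2, h1, hR.1 _ _ _ h3⟩
  · rintro ⟨h1, h2, h3⟩; exact ⟨h2, h1, hR.1 _ _ _ h3⟩

/-- The full block relation of a class. -/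
def Full (k : Gp n) : Pt n → Pt n → Pt n → Prop :=
  S.Rel k (fun _ _ => True) (fun _ _ => True)

theorem full_symm (k : Gp n) : SymRel (S.Full k) :=
  S.rel_symm (fun _ _ _ _ => trivial)

theorem cnt_full (k : Gp n) {u v : Pt n} (huv : u ≠ v) : cnt (S.Full k) u v = 2 := by
  classical
  by_cases h : u.1 = v.1
  · obtain ⟨i, a⟩ := u
    obtain ⟨j, b⟩ := v
    obtain rfl : i = j := h
    obtain ⟨w, -, hw⟩ := S.cnt_same (k := k) (φ := fun _ _ => True) (ψ := fun _ _ => True)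
      (i := i) (a := a) (b := b) (fun e => huv (by rw [e]))
    unfold Full
    rw [hw]
    simp
  · unfold Full
    rw [S.cnt_cross (fun _ _ _ _ => trivial) h]
    rcases S.c k u with ⟨p, x⟩
    rcases S.c k v with ⟨q, y⟩
    by_cases hpq : p = q
    · subst hpq
      cases x <;> cases y <;> simp
    · simp [hpq, Ne.symm hpq]

/-- The selection rule used in the class `k0`. -/
def phi (h : Gp n → Gp n → Prop) (u w : Pt n) : Prop :=
  w.1 = u.1 + 1 ↔ h (S.c S.k0 u) (S.c S.k0 w)

/-- The selected relation in the class `k0`. -/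
def Sel (h : Gp n → Gp n → Prop) (Q : ZMod n → Prop) : Pt n → Pt n → Pt n → Prop :=
  S.Rel S.k0 (S.phi h) (fun b q => b = true ↔ Q q)

theorem phi_compat {h : Gp n → Gp n → Prop} 
    (h2 : ∀ a b, h a (S.M a b) → h b (S.M a b)) : S.Compat S.k0 (S.phi h) := by
  intro u v w ⟨e1, e2, e3, e4⟩
  unfold phi at *
  rw [S.t0] at e3
  rw [e3] at *
  rw [← e1, e4]
  constructor
  · exact h2 _ _
  · intro hh
    have := h2 (S.c S.k0 v) (S.c S.k0 u)
    rw [S.M_comm] at this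
    exact this hh

theorem sel_symm {h : Gp n → Gp n → Prop} {Q : ZMod n → Prop} 
    (h2 : ∀ a b, h a (S.M a b) → h b (S.M a b)) : SymRel (S.Sel h Q) :=
  S.rel_symm (S.phi_compat h2)

theorem sel_full {h : Gp n → Gp n → Prop} {Q : ZMod n → Prop} {u v w : Pt n}
    (hh : S.Sel h Q u v w) : S.Full S.k0 u v w := by
  rcases hh with hh | hh | hh | hh
  · exact Or.inl ⟨hh.1, hh.2.1, hh.2.2.1, trivial⟩
  · exact Or.inr (Or.inl ⟨hh.1, hh.2.1, hh.2.2.1, trivial⟩)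
  · exact Or.inr (Or.inr (Or.inl ⟨hh.1, hh.2.1, hh.2.2.1, trivial⟩))
  · obtain ⟨h1, h2, h3, h4, h5, h6, h7, h8, h9⟩ := hh
    exact Or.inr (Or.inr (Or.inr ⟨h1, h2, h3, h4, h5, h6, h7, h8, trivial⟩))

theorem cnt_sel_same {h : Gp n → Gp n → Prop} {Q : ZMod n → Prop} {u v : Pt n} (huv : u ≠ v)
    (e : u.1 = v.1) : cnt (S.Sel h Q) u v = 1 := by
  classical
  obtain ⟨i, a⟩ := u
  obtain ⟨j, b⟩ := v
  obtain rfl : i = j := e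
  obtain ⟨w, hw, hc⟩ := S.cnt_same (k := S.k0) (φ := S.phi h) 
    (ψ := fun b q => b = true ↔ Q q) (i := i) (a := a) (b := b) (fun e => huv (by rw [e]))
  unfold Sel
  rw [hc]
  have e3 : i + 2 ≠ i + 1 := by clear * -; revert i; decide
  have c1 : S.c S.k0 (i + 1, w (i + 1)) = S.c S.k0 (i + 2, w (i + 2)) := by
    unfold c; rw [hw, hw]
  unfold phi
  rw [c1]
  simp only [e3, false_iff, true_iff]
  by_cases hh : h (S.c S.k0 (i, a)) (S.c S.k0 (i + 2, w (i + 2))) <;> simp [hh]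

open Classical in
theorem cnt_sel_cross {h : Gp n → Gp n → Prop} {Q : ZMod n → Prop} (h1 : ∀ a b, h a b → h b a)
    (h2 : ∀ a b, h a (S.M a b) → h b (S.M a b)) (h3 : ∀ q, h (q, false) (q, true) ↔ Q q)
    {u v : Pt n} (huv : v.1 = u.1 + 1) :
    cnt (S.Sel h Q) u v =
      if (S.c S.k0 u).1 = (S.c S.k0 v).1 ∧ (S.c S.k0 u).2 = true ∧ (S.c S.k0 v).2 = false then
        (if Q (S.c S.k0 u).1 then 0 else 2) else 1 := by
  have e1 : u.1 ≠ v.1 := by rw [huv]; generalize u.1 = i; clear * -; revert i; decide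
  have e2 : ¬ (u.1 = v.1 + 1) := by rw [huv]; generalize u.1 = i; clear * -; revert i; decide
  unfold Sel
  rw [S.cnt_cross (S.phi_compat h2) e1]
  have p1 : S.phi h u v ↔ h (S.c S.k0 u) (S.c S.k0 v) := by
    unfold phi; simp [huv]
  have p2 : S.phi h v u ↔ ¬ h (S.c S.k0 u) (S.c S.k0 v) := by
    unfold phi
    have : h (S.c S.k0 v) (S.c S.k0 u) ↔ h (S.c S.k0 u) (S.c S.k0 v) := ⟨h1 _ _, h1 _ _⟩
    rw [this]; simp [e2]
  simp only [p1, p2]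
  rcases S.c S.k0 u with ⟨p, x⟩
  rcases S.c S.k0 v with ⟨q, y⟩
  by_cases hpq : p = q
  · subst hpq
    have h3' : h (p, true) (p, false) ↔ Q p := ⟨fun e => (h3 p).1 (h1 _ _ e), fun e =>
      h1 _ _ ((h3 p).2 e)⟩
    by_cases hQ : Q p
    · cases x <;> cases y <;> simp [hQ, h3, h3'] <;> split_ifs <;> rfl
    · cases x <;> cases y <;> simp [hQ, h3, h3'] <;> split_ifs <;> rfl
  · have : ∀ b, (p, b) ≠ (q, false) := fun b e => hpq (Prod.ext_iff.1 e).1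
    simp [hpq, Ne.symm hpq]
    by_cases hh : h (p, x) (q, y) <;> simp [hh]

/-! ### Exactly one class -/

theorem full_inside {k : Gp n} {u v w : Pt n} (h1 : u.1 = v.1) (h2 : u.1 = w.1) :
    ¬ S.Full k u v w := by
  rintro (h | h | h | h)
  · exact h.2.1 h2.symm
  · exact h.2.1 h1.symm
  · exact h.2.1 h1
  · exact h.1 h1

theorem full_two {u v w : Pt n} (h1 : u.1 = v.1) (h2 : w.1 ≠ u.1) :
    ∃! k, S.Full k u v w := by
  obtain ⟨k, hk, hu⟩ := S.exu u.1 w.1 (S.M (S.c S.k0 u) (S.c S.k0 v)) w.2 (Ne.symm h2)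
  refine ⟨k, Or.inl ⟨h1, h2, hk, trivial⟩, ?_⟩
  rintro k' (h | h | h | h)
  · exact hu _ h.2.2.1
  · exact absurd h.1.symm h2
  · exact absurd (h1.trans h.1).symm h2
  · exact absurd h1 h.1

/-- The transversal relations. -/
def Sm (s : ZMod (2 * n)) (u v w : Pt n) : Prop :=
  u.1 ≠ v.1 ∧ u.1 ≠ w.1 ∧ v.1 ≠ w.1 ∧ S.Θ u.2 + S.Θ v.2 + S.Θ w.2 = s

theorem sm_symm (s : ZMod (2 * n)) : SymRel (S.Sm s) := by
  constructor
  · rintro u v w ⟨h1, h2, h3, h4⟩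
    exact ⟨h1.symm, h3, h2, by rw [← h4]; ring⟩
  · rintro u v w ⟨h1, h2, h3, h4⟩
    exact ⟨h2, h1, h3.symm, by rw [← h4]; ring⟩

theorem full_tr_iff {k : Gp n} {u v w : Pt n} (h1 : u.1 ≠ v.1) (h2 : u.1 ≠ w.1)
    (h3 : v.1 ≠ w.1) : S.Full k u v w ↔ S.Tr k (fun _ _ => True) u v w := by
  constructor
  · rintro (h | h | h | h)
    · exact absurd h.1 h1
    · exact absurd h.1 h2
    · exact absurd h.1 h3
    · exact h
  · exact fun h => Or.inr (Or.inr (Or.inr h))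

/-- Sorted transversal triples. -/
theorem full_tr0 (x y z : Gp n) (hs : S.Θ x + S.Θ y + S.Θ z = 0 ∨ S.Θ x + S.Θ y + S.Θ z = 1) :
    ∃! k, S.Full k (0, x) (1, y) (2, z) := by
  obtain ⟨k, ⟨a1, a2, a3, a4, a5⟩, hu⟩ := S.tr1 x y z hs
  refine ⟨k, (S.full_tr_iff (by simp) (by simp) (by simp)).2
    ⟨by simp, by simp, by simp, a1, a2, a3, a4, a5, trivial⟩, ?_⟩
  intro k' hk'
  obtain ⟨-, -, -, b1, b2, b3, b4, b5, -⟩ :=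
    (S.full_tr_iff (by simp) (by simp) (by simp)).1 hk'
  exact hu k' ⟨b1, b2, b3, b4, b5⟩

theorem full_tr0' (x y z : Gp n) (k : Gp n) (h : S.Full k (0, x) (1, y) (2, z)) :
    S.Θ x + S.Θ y + S.Θ z = 0 ∨ S.Θ x + S.Θ y + S.Θ z = 1 := by
  obtain ⟨-, -, -, b1, b2, b3, b4, b5, -⟩ :=
    (S.full_tr_iff (by simp) (by simp) (by simp)).1 h
  exact S.tr2 x y z k b1 b2 b3 b4 b5

theorem cnt_sm (s : ZMod (2 * n)) {u v : Pt n} (huv : u.1 ≠ v.1) : cnt (S.Sm s) u v = 1 := by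
  classical
  unfold cnt
  apply card_filter_one
  obtain ⟨l, hl1, hl2⟩ := third_exists _ _ huv
  obtain ⟨g, hg⟩ := S.Θ_bij.2 (s - S.Θ u.2 - S.Θ v.2)
  refine ⟨(l, g), ⟨fun e => hl1 (by rw [← e]), fun e => hl2 (by rw [← e]), huv, hl1, hl2,
    by simp only [hg]; ring⟩, ?_⟩
  rintro ⟨l', g'⟩ ⟨-, -, -, a1, a2, a3⟩
  have hl : l' = l := by
    simp only at a1 a2
    generalize u.1 = i at *
    generalize v.1 = j at *
    clear * - huv hl1 hl2 a1 a2
    revert i j l l'; decide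
  have : g' = g := S.Θ_bij.1 (by rw [hg, ← a3]; ring)
  rw [hl, this]

end Sys

/-! ### Assembling the design -/

namespace Sys

variable {n : ℕ} [NeZero n] (S : Sys n)

/-- Enumeration of the classes. -/
def enc (n : ℕ) (i : ℕ) : Gp n := (((i / 2 : ℕ) : ZMod n), decide (i % 2 = 1))

theorem enc_inj {i j : ℕ} (hi : i < 2 * n) (hj : j < 2 * n) (h : enc n i = enc n j) : i = j := by
  unfold enc at h
  obtain ⟨h1, h2⟩ := Prod.ext_iff.1 h
  have h1' := congrArg ZMod.val h1
  simp only at h1' h2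
  rw [ZMod.val_natCast_of_lt (by omega), ZMod.val_natCast_of_lt (by omega)] at h1'
  have : i % 2 = 1 ↔ j % 2 = 1 := by simpa using h2
  omega

theorem enc_surj (k : Gp n) : ∃ i, i < 2 * n ∧ enc n i = k := by
  obtain ⟨q, b⟩ := k
  have hq := ZMod.val_lt q
  refine ⟨2 * q.val + b.toNat, by cases b <;> simp <;> omega, ?_⟩
  have e : (2 * q.val + b.toNat) / 2 = q.val := by cases b <;> simp <;> omega
  unfold enc
  rw [e, ZMod.natCast_zmod_val]
  cases b <;> simp <;> omega

/-- All block relations. -/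
def BR (i : ℕ) : Pt n → Pt n → Pt n → Prop :=
  if i < 2 * n then S.Full (enc n i) else S.Sm ((i - 2 * n + 2 : ℕ) : ZMod (2 * n))

theorem br_lt {i : ℕ} (h : i < 2 * n) : S.BR i = S.Full (enc n i) := if_pos h

theorem br_ge {i : ℕ} (h : ¬ i < 2 * n) :
    S.BR i = S.Sm ((i - 2 * n + 2 : ℕ) : ZMod (2 * n)) := if_neg h

theorem br_symm (i : ℕ) : SymRel (S.BR i) := by
  by_cases h : i < 2 * n
  · rw [S.br_lt h]; exact S.full_symm _
  · rw [S.br_ge h]; exact S.sm_symm _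

theorem cast_ne {j : ℕ} (h1 : 2 ≤ j) (h2 : j < 2 * n) :
    ((j : ℕ) : ZMod (2 * n)) ≠ 0 ∧ ((j : ℕ) : ZMod (2 * n)) ≠ 1 := by
  have : Fact (1 < 2 * n) := ⟨by omega⟩
  constructor
  · intro e
    have := congrArg ZMod.val e
    rw [ZMod.val_natCast_of_lt h2, ZMod.val_zero] at this
    omega
  · intro e
    have := congrArg ZMod.val e
    rw [ZMod.val_natCast_of_lt h2, ZMod.val_one] at this
    omega

/-- The triple lies in exactly one class. -/
def Once (u v w : Pt n) : Prop := ∃! i : Fin (4 * n - 2), S.BR i u v w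

theorem once_symm : SymRel S.Once := by
  constructor
  · rintro u v w ⟨i, h, hu⟩
    exact ⟨i, (S.br_symm _).1 _ _ _ h, fun j hj => hu j ((S.br_symm _).1 _ _ _ hj)⟩
  · rintro u v w ⟨i, h, hu⟩
    exact ⟨i, (S.br_symm _).2 _ _ _ h, fun j hj => hu j ((S.br_symm _).2 _ _ _ hj)⟩

theorem once_of_full {u v w : Pt n} (h : ∃! k, S.Full k u v w)
    (h' : ∀ j, 2 ≤ j → j < 2 * n → ¬ S.Sm ((j : ℕ) : ZMod (2 * n)) u v w) : S.Once u v w := by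
  have hn : 0 < n := Nat.pos_of_ne_zero (NeZero.ne n)
  obtain ⟨k, hk, hu⟩ := h
  obtain ⟨i, hi, rfl⟩ := enc_surj k
  refine ⟨⟨i, by omega⟩, by simp only; rw [S.br_lt hi]; exact hk, ?_⟩
  rintro ⟨j, hj⟩ hB
  simp only at hB
  by_cases hj' : j < 2 * n
  · rw [S.br_lt hj'] at hB
    exact Fin.ext (enc_inj hj' hi (hu _ hB))
  · rw [S.br_ge hj'] at hB
    exact absurd hB (h' _ (by omega) (by omega))

theorem once_two {u v w : Pt n} (h1 : u.1 = v.1) (h2 : w.1 ≠ u.1) : S.Once u v w :=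
  S.once_of_full (S.full_two h1 h2) (fun _ _ _ h => h.1 h1)

theorem once_tr0 (x y z : Gp n) : S.Once (0, x) (1, y) (2, z) := by
  have hn : 0 < n := Nat.pos_of_ne_zero (NeZero.ne n)
  by_cases hs : S.Θ x + S.Θ y + S.Θ z = 0 ∨ S.Θ x + S.Θ y + S.Θ z = 1
  · apply S.once_of_full (S.full_tr0 x y z hs)
    rintro j h1 h2 ⟨-, -, -, h⟩
    simp only at h
    rw [h] at hs
    exact hs.elim (cast_ne h1 h2).1 (cast_ne h1 h2).2
  · have hlt := ZMod.val_lt (S.Θ x + S.Θ y + S.Θ z)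
    have hge : 2 ≤ (S.Θ x + S.Θ y + S.Θ z).val := by
      by_contra hc
      apply hs
      rw [← ZMod.natCast_zmod_val (S.Θ x + S.Θ y + S.Θ z)]
      have : (S.Θ x + S.Θ y + S.Θ z).val = 0 ∨ (S.Θ x + S.Θ y + S.Θ z).val = 1 := by omega
      rcases this with h | h <;> rw [h] <;> simp
    refine ⟨⟨2 * n + (S.Θ x + S.Θ y + S.Θ z).val - 2, by omega⟩, ?_, ?_⟩
    · simp only
      rw [S.br_ge (by omega)]
      refine ⟨by simp, by simp, by simp, ?_⟩
      rw [show 2 * n + (S.Θ x + S.Θ y + S.Θ z).val - 2 - 2 * n + 2 =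
        (S.Θ x + S.Θ y + S.Θ z).val by omega, ZMod.natCast_zmod_val]
    · rintro ⟨j, hj⟩ hB
      simp only at hB
      by_cases hj' : j < 2 * n
      · rw [S.br_lt hj'] at hB
        exact absurd (S.full_tr0' _ _ _ _ hB) hs
      · rw [S.br_ge hj'] at hB
        have := hB.2.2.2
        simp only at this
        apply Fin.ext
        simp only
        rw [this, ZMod.val_natCast_of_lt (by omega)]
        omega

theorem once_all {u v w : Pt n} (h : ¬ (u.1 = v.1 ∧ u.1 = w.1)) : S.Once u v w := by
  obtain ⟨s1, s2⟩ := S.once_symm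
  by_cases h1 : u.1 = v.1
  · exact S.once_two h1 (fun e => h ⟨h1, e.symm⟩)
  by_cases h2 : u.1 = w.1
  · exact s2 _ _ _ (S.once_two h2 (Ne.symm h1))
  by_cases h3 : v.1 = w.1
  · exact s1 _ _ _ (s2 _ _ _ (S.once_two h3 h1))
  obtain ⟨i, x⟩ := u
  obtain ⟨j, y⟩ := v
  obtain ⟨k, z⟩ := w
  simp only at h1 h2 h3
  clear h
  have key : (i = 0 ∧ j = 1 ∧ k = 2) ∨ (i = 0 ∧ j = 2 ∧ k = 1) ∨ (i = 1 ∧ j = 0 ∧ k = 2) ∨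
      (i = 1 ∧ j = 2 ∧ k = 0) ∨ (i = 2 ∧ j = 0 ∧ k = 1) ∨ (i = 2 ∧ j = 1 ∧ k = 0) := by
    clear s1 s2
    revert i j k; decide
  rcases key with ⟨rfl, rfl, rfl⟩ | ⟨rfl, rfl, rfl⟩ | ⟨rfl, rfl, rfl⟩ | ⟨rfl, rfl, rfl⟩ |
    ⟨rfl, rfl, rfl⟩ | ⟨rfl, rfl, rfl⟩
  · exact S.once_tr0 x y z
  · exact s2 _ _ _ (S.once_tr0 x z y)
  · exact s1 _ _ _ (S.once_tr0 y x z)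
  · exact s2 _ _ _ (s1 _ _ _ (S.once_tr0 z x y))
  · exact s1 _ _ _ (s2 _ _ _ (S.once_tr0 y z x))
  · exact s1 _ _ _ (s2 _ _ _ (s1 _ _ _ (S.once_tr0 z y x)))

theorem br_inside {i : ℕ} {u v w : Pt n} (h1 : u.1 = v.1) (h2 : u.1 = w.1) :
    ¬ S.BR i u v w := by
  by_cases h : i < 2 * n
  · rw [S.br_lt h]; exact S.full_inside h1 h2
  · rw [S.br_ge h]; exact fun hh => hh.1 h1

/-! ### The matching -/

/-- Index of the matching edge containing a point. -/
def own (u : Pt n) : ℕ :=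
  3 * (S.c S.k0 u).1.val + (if (S.c S.k0 u).2 = true then u.1 else u.1 + 2).val

theorem own_lt (u : Pt n) : S.own u < 3 * n := by
  unfold own
  have := ZMod.val_lt (S.c S.k0 u).1
  have := (if (S.c S.k0 u).2 = true then u.1 else u.1 + 2).isLt
  omega

theorem own_eq {u v : Pt n} (h : v.1 = u.1 + 1) (h1 : (S.c S.k0 u).1 = (S.c S.k0 v).1)
    (h2 : (S.c S.k0 u).2 = true) (h3 : (S.c S.k0 v).2 = false) : S.own u = S.own v := by
  unfold own
  rw [h1, h2, h3, h]
  simp only [if_true]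
  have : u.1 = u.1 + 1 + 2 := by generalize u.1 = i; revert i; decide
  simp [← this]

theorem own_pair {t : ℕ} (ht : t < 3 * n) : ∃ u v : Pt n, v.1 = u.1 + 1 ∧
    (S.c S.k0 u).1 = (S.c S.k0 v).1 ∧ (S.c S.k0 u).2 = true ∧ (S.c S.k0 v).2 = false ∧
    (S.c S.k0 u).1.val = t / 3 ∧ ∀ w, S.own w = t ↔ (w = u ∨ w = v) := by
  obtain ⟨i, hi⟩ : ∃ i : Fin 3, i.val = t % 3 := ⟨⟨t % 3, by omega⟩, rfl⟩
  obtain ⟨q, hq⟩ : ∃ q : ZMod n, q.val = t / 3 :=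
    ⟨((t / 3 : ℕ) : ZMod n), ZMod.val_natCast_of_lt (by omega)⟩
  obtain ⟨a, ha⟩ := (S.C_bij S.k0 i).2 (q, true)
  obtain ⟨b, hb⟩ := (S.C_bij S.k0 (i + 1)).2 (q, false)
  have hcu : S.c S.k0 (i, a) = (q, true) := ha
  have hcv : S.c S.k0 (i + 1, b) = (q, false) := hb
  have hou : S.own (i, a) = t := by
    unfold own; rw [hcu]; simp only [if_true]; omega
  refine ⟨(i, a), (i + 1, b), rfl, by rw [hcu, hcv], by rw [hcu], by rw [hcv], by rw [hcu]; exact hq,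
    ?_⟩
  intro w
  constructor
  · intro h
    obtain ⟨j, g⟩ := w
    unfold own at h
    have hc : S.c S.k0 (j, g) = S.C S.k0 j g := rfl
    rw [hc] at h
    rcases hC : S.C S.k0 j g with ⟨p, x⟩
    rw [hC] at h
    simp only at h
    have hp : p = q := by
      apply ZMod.val_injective
      have := (if x = true then j else j + 2).isLt
      omega
    subst hp
    have hj : (if x = true then j else j + 2) = i := by
      apply Fin.ext; omega
    cases x
    · right
      have : j = i + 1 := by
        rw [← hj]; clear * -; revert j; decide
      subst this
      rw [(S.C_bij S.k0 _).1 (hC.trans hb.symm)]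
    · left
      have : j = i := by simpa using hj
      subst this
      rw [(S.C_bij S.k0 _).1 (hC.trans ha.symm)]
  · rintro (rfl | rfl)
    · exact hou
    · rw [← hou]
      exact (S.own_eq rfl (by rw [hcu, hcv]) (by rw [hcu]) (by rw [hcv])).symm

/-! ### Transport to an arbitrary point set -/

theorem pull_symm {β : Type} (e : β ≃ Pt n) {R : Pt n → Pt n → Pt n → Prop} (hR : SymRel R) :
    SymRel (fun x y z => R (e x) (e y) (e z)) :=
  ⟨fun _ _ _ h => hR.1 _ _ _ h, fun _ _ _ h => hR.2 _ _ _ h⟩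

theorem lam_pull {β : Type} [Fintype β] [DecidableEq β] (e : β ≃ Pt n)
    {R : Pt n → Pt n → Pt n → Prop} (hR : SymRel R) {a b : β} (hab : a ≠ b) :
    lamF (fam fun x y z => R (e x) (e y) (e z)) {a, b} = cnt R (e a) (e b) := by
  classical
  rw [lamF_pair (pull_symm e hR) hab]
  unfold cnt
  rw [← card_filter_bij e.bijective]
  congr 1
  ext w
  simp

/-- The groups. -/
def grp {β : Type} [Fintype β] (e : β ≃ Pt n) (i : Fin 3) : Finset β :=
  Finset.univ.filter fun a => (e a).1 = i

theorem mem_grp {β : Type} [Fintype β] {e : β ≃ Pt n} {i : Fin 3} {a : β} :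
    a ∈ grp e i ↔ (e a).1 = i := by simp [grp]

theorem card_grp {β : Type} [Fintype β] (e : β ≃ Pt n) (i : Fin 3) :
    (grp e i).card = 2 * n := by
  unfold grp
  rw [card_filter_bij e.bijective (fun w : Pt n => w.1 = i)]
  have : (Finset.univ.filter fun w : Pt n => w.1 = i) = {i} ×ˢ (Finset.univ : Finset (Gp n)) := by
    ext ⟨j, g⟩; simp [eq_comm]
  rw [this, Finset.card_product, Finset.card_singleton, Finset.card_univ, Fintype.card_prod,
    ZMod.card, Fintype.card_bool]
  ring

section Final

variable (e : Fin (6 * n) ≃ Pt n)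

/-- The parts. -/
noncomputable def part (i : ℕ) : Multiset (Finset (Fin (6 * n))) :=
  fam fun x y z => S.BR i (e x) (e y) (e z)

theorem is_cs : IsCS Finset.univ (2 * n) 3 0 (∅ : Finset (Fin (6 * n))) (grp e)
    (∑ i : Fin (4 * n - 2), S.part e i) := by
  classical
  refine ⟨rfl, Finset.subset_univ _, fun i => ⟨card_grp e i, Finset.subset_univ _⟩, ?_,
    fun i => Finset.disjoint_empty_right _, ?_, ?_, ?_, ?_⟩
  · intro i j hij
    rw [Finset.disjoint_left]
    intro a h1 h2
    exact hij ((mem_grp.1 h1).symm.trans (mem_grp.1 h2))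
  · ext a
    simp [mem_grp]
  · intro B hB
    rw [Multiset.mem_sum] at hB
    obtain ⟨i, -, hi⟩ := hB
    exact ⟨card_of_mem_fam hi, Finset.subset_univ _⟩
  · intro T hT hG
    have h3 := (Finset.mem_powersetCard.1 hT).2
    obtain ⟨a, b, c, hab, hac, hbc, rfl⟩ := Finset.card_eq_three.1 h3
    have hne : ¬ ((e a).1 = (e b).1 ∧ (e a).1 = (e c).1) := by
      rintro ⟨h1, h2⟩
      apply hG (e a).1
      intro x hx
      simp only [Finset.mem_insert, Finset.mem_singleton] at hx
      rw [Finset.empty_union, mem_grp]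
      rcases hx with rfl | rfl | rfl
      · rfl
      · exact h1.symm
      · exact h2.symm
    rw [lamF_sum, ← card_filter_one (S.once_all hne), Finset.card_filter]
    apply Finset.sum_congr rfl
    intro i _
    unfold part
    rw [lamF_triple h3]
    exact if_congr (mem_fam_triple (pull_symm e (S.br_symm _)) hab hac hbc) rfl rfl
  · rintro T hT ⟨i, hi⟩
    have h3 := (Finset.mem_powersetCard.1 hT).2
    obtain ⟨a, b, c, hab, hac, hbc, rfl⟩ := Finset.card_eq_three.1 h3
    rw [Finset.empty_union] at hi
    have ha := mem_grp.1 (hi (by simp : a ∈ _))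
    have hb := mem_grp.1 (hi (by simp : b ∈ _))
    have hc := mem_grp.1 (hi (by simp : c ∈ _))
    rw [lamF_sum]
    apply Finset.sum_eq_zero
    intro j _
    unfold part
    rw [lamF_triple h3, if_neg]
    rw [mem_fam_triple (pull_symm e (S.br_symm _)) hab hac hbc]
    exact S.br_inside (ha.trans hb.symm) (ha.trans hc.symm)

theorem is_ngdd {h : Gp n → Gp n → Prop} {Q : ZMod n → Prop} (h1 : ∀ a b, h a b → h b a)
    (h2 : ∀ a b, h a (S.M a b) → h b (S.M a b)) (h3 : ∀ q, h (q, false) (q, true) ↔ Q q)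
    (r : ℕ) (hr : r ≤ 3 * n) (hQ : ∀ q t, q.val = t / 3 → (Q q ↔ r ≤ t)) :
    IsNGDD Finset.univ r (3 * n - r) 0
      (fun t => Finset.univ.filter fun a => S.own (e a) = (t : ℕ)) ∅
      (fam fun x y z => S.Sel h Q (e x) (e y) (e z)) := by
  classical
  have hsym : SymRel (S.Sel h Q) := S.sel_symm h2
  have hpair : ∀ t : Fin (r + (3 * n - r)), ∃ u v : Pt n, v.1 = u.1 + 1 ∧
      (S.c S.k0 u).1 = (S.c S.k0 v).1 ∧ (S.c S.k0 u).2 = true ∧ (S.c S.k0 v).2 = false ∧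
      (S.c S.k0 u).1.val = (t : ℕ) / 3 ∧ e.symm u ≠ e.symm v ∧
      (Finset.univ.filter fun a => S.own (e a) = (t : ℕ)) = {e.symm u, e.symm v} := by
    intro t
    obtain ⟨u, v, a1, a2, a3, a4, a5, a6⟩ := S.own_pair (t := t) (by omega)
    refine ⟨u, v, a1, a2, a3, a4, a5, ?_, ?_⟩
    · intro hh
      have := e.symm.injective hh
      rw [this, a4] at a3
      exact absurd a3 (by simp)
    · ext a
      simp only [Finset.mem_filter, Finset.mem_univ, true_and, a6, Finset.mem_insert,
        Finset.mem_singleton, Equiv.eq_symm_apply]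
  have hlam : ∀ t : Fin (r + (3 * n - r)), lamF (fam fun x y z => S.Sel h Q (e x) (e y) (e z))
      (Finset.univ.filter fun a => S.own (e a) = (t : ℕ)) = if r ≤ (t : ℕ) then 0 else 2 := by
    intro t
    obtain ⟨u, v, a1, a2, a3, a4, a5, a6, a7⟩ := hpair t
    rw [a7, lam_pull e hsym a6, Equiv.apply_symm_apply, Equiv.apply_symm_apply,
      S.cnt_sel_cross h1 h2 h3 a1, if_pos ⟨a2, a3, a4⟩]
    exact if_congr (hQ _ _ a5) rfl rfl
  refine ⟨?_, rfl, Finset.subset_univ _, ?_, fun i => Finset.disjoint_empty_right _, ?_, ?_, ?_,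
    ?_, ?_, ?_⟩
  · intro t
    obtain ⟨u, v, -, -, -, -, -, a6, a7⟩ := hpair t
    refine ⟨?_, Finset.subset_univ _⟩
    simp only
    rw [a7, Finset.card_pair a6]
  · intro i j hij
    rw [Finset.disjoint_left]
    intro a b1 b2
    simp only [Finset.mem_filter, Finset.mem_univ, true_and] at b1 b2
    exact hij (Fin.ext (b1.symm.trans b2))
  · ext a
    simp only [Finset.empty_union, Finset.mem_biUnion, Finset.mem_univ, true_and,
      Finset.mem_filter, iff_true]
    have := S.own_lt (e a)
    exact ⟨⟨S.own (e a), by omega⟩, rfl⟩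
  · intro A hA
    exact ⟨card_of_mem_fam hA, Finset.subset_univ _⟩
  · intro i hi
    simp only
    rw [hlam, if_neg (by omega)]
  · intro i hi
    simp only
    rw [hlam, if_pos hi]
  · intro p hp
    simp at hp
    obtain ⟨rfl, hp⟩ := hp
    simp at hp
  · intro p hp hno _
    obtain ⟨a, b, hab, rfl⟩ := Finset.card_eq_two.1 (Finset.mem_powersetCard.1 hp).2
    have hown : S.own (e a) ≠ S.own (e b) := by
      intro hh
      have := S.own_lt (e a)
      apply hno ⟨S.own (e a), by omega⟩
      intro x hx
      simp only [Finset.mem_insert, Finset.mem_singleton] at hx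
      simp only [Finset.mem_filter, Finset.mem_univ, true_and]
      rcases hx with rfl | rfl
      · rfl
      · exact hh.symm
    rw [lam_pull e hsym hab]
    have key : ∀ i j : Fin 3, i = j ∨ j = i + 1 ∨ i = j + 1 := by decide
    rcases key (e a).1 (e b).1 with g | g | g
    · exact S.cnt_sel_same (fun hh => hab (e.injective hh)) g
    · rw [S.cnt_sel_cross h1 h2 h3 g, if_neg]
      rintro ⟨b1, b2, b3⟩
      exact hown (S.own_eq g b1 b2 b3)
    · rw [cnt_comm hsym, S.cnt_sel_cross h1 h2 h3 g, if_neg]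
      rintro ⟨b1, b2, b3⟩
      exact hown (S.own_eq g b1 b2 b3).symm

theorem is_pics (r : ℕ) (hr : r ≤ 3 * n) (hr3 : r % 3 = 0) :
    IsPICS2 n r (grp e) (∑ i : Fin (4 * n - 2), S.part e i) := by
  have hn : 0 < n := Nat.pos_of_ne_zero (NeZero.ne n)
  refine ⟨S.is_cs e, fun i => S.part e i, rfl, ?_, ?_, ?_⟩
  · intro i hi
    refine ⟨fun A hA => ⟨card_of_mem_fam hA, Finset.subset_univ _⟩, ?_⟩
    intro p hp
    obtain ⟨a, b, hab, rfl⟩ := Finset.card_eq_two.1 (Finset.mem_powersetCard.1 hp).2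
    unfold part
    rw [lam_pull e (S.br_symm _) hab, S.br_lt hi]
    exact S.cnt_full _ (fun hh => hab (e.injective hh))
  · obtain ⟨h, h1, h2, h3⟩ := S.hex (fun q => r / 3 ≤ q.val)
    obtain ⟨i, hi, hk⟩ := enc_surj S.k0
    refine ⟨⟨i, by omega⟩, hi, _, _, ?_, S.is_ngdd e h1 h2 h3 r hr ?_⟩
    · unfold part
      apply fam_mono
      intro u v w hh
      simp only
      rw [S.br_lt hi, hk]
      exact S.sel_full hh
    · intro q t hq
      rw [hq]
      omega
  · intro i hi
    refine ⟨?_, ?_⟩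
    · intro A hA
      refine ⟨card_of_mem_fam hA, ?_, ?_⟩
      · intro x _
        simp [mem_grp]
      · intro j
        obtain ⟨u, v, w, -, -, -, hB, rfl⟩ := mem_fam.1 hA
        rw [S.br_ge (by omega)] at hB
        obtain ⟨b1, b2, b3, -⟩ := hB
        rw [Finset.card_le_one]
        intro x hx y hy
        simp only [Finset.mem_inter, Finset.mem_insert, Finset.mem_singleton, mem_grp] at hx hy
        obtain ⟨hx1, hx2⟩ := hx
        obtain ⟨hy1, hy2⟩ := hy
        have hxy := hx2.trans hy2.symm
        rcases hx1 with rfl | rfl | rfl <;> rcases hy1 with rfl | rfl | rfl <;>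
          first | rfl | exact absurd hxy b1 | exact absurd hxy b2 | exact absurd hxy b3 |
            exact absurd hxy.symm b1 | exact absurd hxy.symm b2 | exact absurd hxy.symm b3
    · rintro x y hxy ⟨j, l, hjl, hx, hy⟩
      unfold part
      rw [lam_pull e (S.br_symm _) hxy, S.br_ge (by omega)]
      apply S.cnt_sm
      rw [mem_grp.1 hx, mem_grp.1 hy]
      exact hjl

end Final

theorem exists_pics (S : Sys n) (r : ℕ) (hr : r ≤ 3 * n) (hr3 : r % 3 = 0) :
    ∃ (G : Fin 3 → Finset (Fin (6 * n))) (A : Multiset (Finset (Fin (6 * n)))),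
      IsPICS2 n r G A := by
  have hc : Fintype.card (Pt n) = 6 * n := by
    rw [Fintype.card_prod, Fintype.card_prod, ZMod.card, Fintype.card_bool, Fintype.card_fin]
    ring
  exact ⟨_, _, S.is_pics (Fintype.equivFinOfCardEq hc).symm r hr hr3⟩

end Sys

/-! ### The two labellings of a group by `ZMod (2 * n)` -/

section Lab

variable {n : ℕ} [NeZero n]

/-- First labelling. -/
def Th (a : Gp n) : ZMod (2 * n) := ((2 * a.1.val + a.2.toNat : ℕ) : ZMod (2 * n))

/-- Second labelling. -/
def lab (a : Gp n) : ZMod (2 * n) := ((a.1.val + n * a.2.toNat : ℕ) : ZMod (2 * n))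

theorem card_gp : Fintype.card (Gp n) = Fintype.card (ZMod (2 * n)) := by
  rw [Fintype.card_prod, ZMod.card, ZMod.card, Fintype.card_bool]
  ring

theorem cast_inj {a b : ℕ} (ha : a < 2 * n) (hb : b < 2 * n)
    (h : (a : ZMod (2 * n)) = (b : ZMod (2 * n))) : a = b := by
  have := congrArg ZMod.val h
  rwa [ZMod.val_natCast_of_lt ha, ZMod.val_natCast_of_lt hb] at this

theorem Th_bij : Function.Bijective (Th (n := n)) := by
  rw [Fintype.bijective_iff_injective_and_card]
  refine ⟨?_, card_gp⟩
  rintro ⟨p, x⟩ ⟨q, y⟩ h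
  have hp := ZMod.val_lt p
  have hq := ZMod.val_lt q
  have := cast_inj (by cases x <;> simp <;> omega) (by cases y <;> simp <;> omega) h
  cases x <;> cases y <;> simp at this ⊢
  · exact ZMod.val_injective _ this
  · omega
  · omega
  · exact ZMod.val_injective _ this

theorem lab_bij : Function.Bijective (lab (n := n)) := by
  rw [Fintype.bijective_iff_injective_and_card]
  refine ⟨?_, card_gp⟩
  rintro ⟨p, x⟩ ⟨q, y⟩ h
  have hp := ZMod.val_lt p
  have hq := ZMod.val_lt q
  have := cast_inj (by cases x <;> simp <;> omega) (by cases y <;> simp <;> omega) h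
  cases x <;> cases y <;> simp at this ⊢
  · exact ZMod.val_injective _ this
  · omega
  · omega
  · exact ZMod.val_injective _ this

/-- The labellings as equivalences. -/
noncomputable def ThE : Gp n ≃ ZMod (2 * n) := Equiv.ofBijective _ Th_bij

/-- The labellings as equivalences. -/
noncomputable def labE : Gp n ≃ ZMod (2 * n) := Equiv.ofBijective _ lab_bij

theorem two_n_zero : (2 : ZMod (2 * n)) * (n : ZMod (2 * n)) = 0 := by
  have := ZMod.natCast_self (2 * n)
  push_cast at this
  exact this

theorem Th_eq (a : Gp n) : ThE a = 2 * labE a + ((a.2.toNat : ℕ) : ZMod (2 * n)) := by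
  have h : (2 : ZMod (2 * n)) * (n : ZMod (2 * n)) = 0 := two_n_zero
  change Th a = 2 * lab a + _
  unfold Th lab
  push_cast
  linear_combination (-(a.2.toNat : ZMod (2 * n))) * h

theorem lab_true (q : ZMod n) :
    labE ((q, true) : Gp n) = labE ((q, false) : Gp n) + (n : ZMod (2 * n)) := by
  change lab _ = lab _ + _
  unfold lab
  simp

/-- The multiplication. -/
noncomputable def Mul (a b : Gp n) : Gp n := ThE.symm (labE a + labE b)

theorem Mul_diag (a : Gp n) : Mul a a = (a.1, false) := by
  unfold Mul
  rw [Equiv.symm_apply_eq]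
  change lab a + lab a = Th _
  have h : (2 : ZMod (2 * n)) * (n : ZMod (2 * n)) = 0 := two_n_zero
  unfold Th lab
  simp
  linear_combination ((a.2.toNat : ZMod (2 * n))) * h

theorem Mul_bij (a : Gp n) : Function.Bijective (Mul a) := by
  have : Mul a = fun b => ThE.symm (Equiv.addLeft (labE a) (labE b)) := rfl
  rw [this]
  exact ThE.symm.bijective.comp ((Equiv.addLeft (labE a)).bijective.comp labE.bijective)

/-- Chains of pairs. -/
inductive Reach (Q : ZMod n → Prop) : Gp n → Gp n → ℕ → Prop
  | start (q : ZMod n) (h : Q q) : Reach Q (q, false) (q, true) n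
  | step (u v : Gp n) (D : ℕ) (h : Reach Q u v D) (hD : D < 2 * n) :
      Reach Q v (labE.symm (ThE v - labE u)) (D + v.2.toNat)

theorem reach_inv {Q : ZMod n → Prop} {u v : Gp n} {D : ℕ} (h : Reach Q u v D) :
    labE v - labE u = (D : ZMod (2 * n)) ∧ n ≤ D ∧ D ≤ 2 * n ∧
      (D = n → ∃ q, Q q ∧ u = (q, false) ∧ v = (q, true)) := by
  have hn : 0 < n := Nat.pos_of_ne_zero (NeZero.ne n)
  induction h with
  | start q h =>
    refine ⟨?_, le_rfl, by omega, fun _ => ⟨q, h, rfl, rfl⟩⟩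
    rw [lab_true]; ring
  | step u v D h hD ih =>
    obtain ⟨h1, h2, h3, h4⟩ := ih
    have hb : v.2.toNat ≤ 1 := Bool.toNat_le _
    refine ⟨?_, by omega, by omega, ?_⟩
    · rw [Equiv.apply_symm_apply, Th_eq]
      push_cast
      rw [← h1]; ring
    · intro hh
      obtain ⟨q, -, -, rfl⟩ := h4 (by omega)
      simp at hh
      omega

/-- The symmetric closure of `Reach`. -/
def hrel (Q : ZMod n → Prop) (u v : Gp n) : Prop := ∃ D, Reach Q u v D ∨ Reach Q v u D

theorem hrel_symm {Q : ZMod n → Prop} {u v : Gp n} (h : hrel Q u v) : hrel Q v u := by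
  obtain ⟨D, h⟩ := h
  exact ⟨D, h.symm⟩

theorem hrel_next {Q : ZMod n → Prop} {u v : Gp n} (h : hrel Q u v) :
    hrel Q v (labE.symm (ThE v - labE u)) := by
  have hn : 0 < n := Nat.pos_of_ne_zero (NeZero.ne n)
  obtain ⟨D, h | h⟩ := h
  · obtain ⟨i1, i2, i3, -⟩ := reach_inv h
    by_cases hD : D < 2 * n
    · exact ⟨_, Or.inl (Reach.step _ _ _ h hD)⟩
    · have hD' : D = 2 * n := by omega
      rw [hD', ZMod.natCast_self, sub_eq_zero] at i1
      have huv : v = u := labE.injective i1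
      cases h with
      | start q h => omega
      | step u' u D' h' hD'' =>
        have e1 : labE u = ThE u - labE u' := by
          rw [← i1, Equiv.apply_symm_apply]
        have e2 : labE.symm (ThE (labE.symm (ThE u - labE u')) - labE u) = u' := by
          rw [huv, Equiv.symm_apply_eq, e1]; ring
        rw [e2, huv]
        exact ⟨D', Or.inr h'⟩
  · cases h with
    | start q h =>
      have e2 : labE.symm (ThE ((q, false) : Gp n) - labE ((q, true) : Gp n)) = (q, true) := by
        rw [Equiv.symm_apply_eq, Th_eq, lab_true]
        have h : (2 : ZMod (2 * n)) * (n : ZMod (2 * n)) = 0 := two_n_zero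
        simp
        linear_combination -h
      rw [e2]
      exact ⟨n, Or.inl (Reach.start q h)⟩
    | step t v D' h' hD'' =>
      have e2 : labE.symm (ThE v - labE (labE.symm (ThE v - labE t))) = t := by
        rw [Equiv.symm_apply_eq, Equiv.apply_symm_apply]; ring
      rw [e2]
      exact ⟨D', Or.inr h'⟩

theorem hrel_mul {Q : ZMod n → Prop} {a b : Gp n} (h : hrel Q a (Mul a b)) :
    hrel Q b (Mul a b) := by
  have := hrel_next h
  have e : labE.symm (ThE (Mul a b) - labE a) = b := by
    unfold Mul
    rw [Equiv.symm_apply_eq, Equiv.apply_symm_apply]; ring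
  rw [e] at this
  exact hrel_symm this

theorem hrel_iff (Q : ZMod n → Prop) (q : ZMod n) : hrel Q (q, false) (q, true) ↔ Q q := by
  have hn : 0 < n := Nat.pos_of_ne_zero (NeZero.ne n)
  have key : ∀ D : ℕ, n ≤ D → D ≤ 2 * n → (n : ZMod (2 * n)) = (D : ZMod (2 * n)) → D = n := by
    intro D h1 h2 h3
    rcases Nat.lt_or_ge D (2 * n) with h | h
    · exact (cast_inj (by omega) h h3).symm
    · have : D = 2 * n := by omega
      rw [this, ZMod.natCast_self] at h3
      have h4 : ((n : ℕ) : ZMod (2 * n)) = ((0 : ℕ) : ZMod (2 * n)) := by simpa using h3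
      have := cast_inj (by omega) (by omega) h4
      omega
  constructor
  · rintro ⟨D, h | h⟩
    · obtain ⟨i1, i2, i3, i4⟩ := reach_inv h
      rw [lab_true, add_sub_cancel_left] at i1
      obtain ⟨q', h1, h2, -⟩ := i4 (key D i2 i3 i1)
      have hq : q = q' := (Prod.ext_iff.1 h2).1
      rw [hq]
      exact h1
    · obtain ⟨i1, i2, i3, i4⟩ := reach_inv h
      rw [lab_true] at i1
      have h : (2 : ZMod (2 * n)) * (n : ZMod (2 * n)) = 0 := two_n_zero
      obtain ⟨q', h1, h2, -⟩ := i4 (key D i2 i3 (by linear_combination i1 + h))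
      simp at h2
  · intro h
    exact ⟨n, Or.inl (Reach.start q h)⟩

end Lab

/-! ### The concrete system -/

section Concrete

variable {n : ℕ} [NeZero n]

/-- Half indicator. -/
def eps (q : ZMod n) : Bool := decide (n % 2 = 0 ∧ n / 2 ≤ q.val)

/-- Bit of a component in a class. -/
def ff (k : Gp n) (q : ZMod n) : Bool := xor k.2 (eps q)

/-- Cast of a bit. -/
def bc (b : Bool) : ZMod n := ((b.toNat : ℕ) : ZMod n)

/-- Fibre index. -/
def J0 (i : Fin 3) (c q f : ZMod n) : ZMod n :=
  match i with
  | 0 => q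
  | 1 => q + c
  | 2 => -(2 * q + f) - c

/-- Fibre index of a component in a class. -/
def J (k : Gp n) (i : Fin 3) (q : ZMod n) : ZMod n := J0 i k.1 q (bc (ff k q))

theorem dbl_inj (k : Gp n) {p q : ZMod n} (h : 2 * p + bc (ff k p) = 2 * q + bc (ff k q)) :
    p = q := by
  have hp := ZMod.val_lt p
  have hq := ZMod.val_lt q
  have h' : ((2 * p.val + (ff k p).toNat : ℕ) : ZMod n) =
      ((2 * q.val + (ff k q).toNat : ℕ) : ZMod n) := by
    push_cast
    rw [ZMod.natCast_zmod_val, ZMod.natCast_zmod_val]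
    exact h
  rw [ZMod.natCast_eq_natCast_iff'] at h'
  have hm : ∀ a, a < 2 * n → a % n = if a < n then a else a - n := by
    intro a ha
    split_ifs with hh
    · exact Nat.mod_eq_of_lt hh
    · rw [Nat.mod_eq_sub_mod (by omega), Nat.mod_eq_of_lt (by omega)]
  have b1 : (ff k p).toNat ≤ 1 := Bool.toNat_le _
  have b2 : (ff k q).toNat ≤ 1 := Bool.toNat_le _
  rw [hm _ (by omega), hm _ (by omega)] at h'
  apply ZMod.val_injective
  have hk : ((ff k p).toNat = (ff k q).toNat) ↔
      ((n % 2 = 0 ∧ n / 2 ≤ p.val) ↔ (n % 2 = 0 ∧ n / 2 ≤ q.val)) := by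
    unfold ff eps
    have gen : ∀ (P P' : Prop) [Decidable P] [Decidable P'] (b : Bool),
        (xor b (decide P)).toNat = (xor b (decide P')).toNat ↔ (P ↔ P') := by
      intro P P' _ _ b
      by_cases c1 : P <;> by_cases c2 : P' <;> cases b <;> simp [c1, c2]
    exact gen _ _ _
  generalize (ff k p).toNat = x at *
  generalize (ff k q).toNat = y at *
  split_ifs at h' <;> omega

theorem J_bij (k : Gp n) (i : Fin 3) : Function.Bijective (J k i) := by
  rw [← Finite.injective_iff_bijective]
  intro p q h
  match i with
  | 0 => exact h
  | 1 => exact add_right_cancel h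
  | 2 =>
    apply dbl_inj k
    have hneg : -(2 * p + bc (ff k p)) - k.1 = -(2 * q + bc (ff k q)) - k.1 := h
    linear_combination -hneg

/-- Component of a fibre. -/
noncomputable def E (k : Gp n) (i : Fin 3) : ZMod n ≃ ZMod n :=
  (Equiv.ofBijective _ (J_bij k i)).symm

theorem E_eq {k : Gp n} {i : Fin 3} {j q : ZMod n} : E k i j = q ↔ j = J k i q := by
  unfold E
  rw [Equiv.symm_apply_eq]
  rfl

/-- Coordinates. -/
noncomputable def CC (k : Gp n) (i : Fin 3) (a : Gp n) : Gp n :=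
  (E k i a.1, xor a.2 (ff k (E k i a.1)))

/-- Translation of coordinates. -/
noncomputable def tt (k : Gp n) (i : Fin 3) (m : Gp n) : Gp n :=
  (E k i ((E (0, false) i).symm m.1), m.2)

theorem CC_bij (k : Gp n) (i : Fin 3) : Function.Bijective (CC k i) := by
  rw [← Finite.injective_iff_bijective]
  rintro ⟨a, x⟩ ⟨b, y⟩ h
  obtain ⟨h1, h2⟩ := Prod.ext_iff.1 h
  have h1' : a = b := (E k i).injective h1
  subst h1'
  simp only [CC] at h2
  have : x = y := by
    revert h2
    cases x <;> cases y <;> cases ff k (E k i a) <;> simp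
  rw [this]

theorem tt_bij (k : Gp n) (i : Fin 3) : Function.Bijective (tt k i) := by
  rw [← Finite.injective_iff_bijective]
  rintro ⟨a, x⟩ ⟨b, y⟩ h
  obtain ⟨h1, h2⟩ := Prod.ext_iff.1 h
  have h1' : a = b := (E (0, false) i).symm.injective ((E k i).injective h1)
  have h2' : x = y := h2
  rw [h1', h2']

theorem J0_solve {i l : Fin 3} (h : i ≠ l) (x y f : ZMod n) : ∃ q c, ∀ q' c',
    (x = J0 i c' q' f ∧ y = J0 l c' q' f) ↔ (q' = q ∧ c' = c) := by
  have main : ∀ i l : Fin 3, i < l → ∀ x y : ZMod n, ∃ q c, ∀ q' c',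
    (x = J0 i c' q' f ∧ y = J0 l c' q' f) ↔ (q' = q ∧ c' = c) := by
    intro i l hil x y
    have key : (i = 0 ∧ l = 1) ∨ (i = 0 ∧ l = 2) ∨ (i = 1 ∧ l = 2) := by
      clear * - hil
      revert i l; decide
    rcases key with ⟨rfl, rfl⟩ | ⟨rfl, rfl⟩ | ⟨rfl, rfl⟩
    · refine ⟨x, y - x, fun q c => ?_⟩
      simp only [J0]
      constructor
      · rintro ⟨rfl, rfl⟩; exact ⟨rfl, by ring⟩
      · rintro ⟨rfl, rfl⟩; exact ⟨rfl, by ring⟩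
    · refine ⟨x, -(2 * x + f) - y, fun q c => ?_⟩
      simp only [J0]
      constructor
      · rintro ⟨rfl, rfl⟩; exact ⟨rfl, by ring⟩
      · rintro ⟨rfl, rfl⟩; exact ⟨rfl, by ring⟩
    · refine ⟨-f - x - y, x - (-f - x - y), fun q c => ?_⟩
      simp only [J0]
      constructor
      · rintro ⟨rfl, rfl⟩; exact ⟨by ring, by ring⟩
      · rintro ⟨rfl, rfl⟩; exact ⟨by ring, by ring⟩
  rcases lt_or_gt_of_ne h with h | h
  · exact main i l h x y
  · obtain ⟨q, c, hh⟩ := main l i h y x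
    exact ⟨q, c, fun q' c' => by rw [← hh, and_comm]⟩

theorem CC_exu (i l : Fin 3) (m y : Gp n) (h : i ≠ l) : ∃! k, CC k l y = tt k i m := by
  obtain ⟨q, c, hqc⟩ := J0_solve h ((E (0, false) i).symm m.1) y.1 (bc (xor y.2 m.2))
  have key : ∀ k : Gp n, CC k l y = tt k i m ↔ k = (c, xor (xor y.2 m.2) (eps q)) := by
    intro k
    unfold CC tt
    rw [Prod.ext_iff]
    simp only
    constructor
    · rintro ⟨h1, h2⟩
      have h3 := E_eq.1 h1
      have h4 := E_eq.1 h1.symm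
      rw [h1] at h2 h4
      generalize hp : E k i ((E (0, false) i).symm m.1) = p at *
      have hf : ff k p = xor y.2 m.2 := by
        rw [← h2]; cases y.2 <;> simp
      have h4' := E_eq.1 hp
      unfold J at h3 h4'
      rw [hf] at h3 h4'
      obtain ⟨rfl, rfl⟩ := (hqc p k.1).1 ⟨h4', h3⟩
      rw [← hf]
      unfold ff
      refine Prod.ext rfl ?_
      cases k.2 <;> simp
    · rintro rfl
      obtain ⟨h1, h2⟩ := (hqc q c).2 ⟨rfl, rfl⟩
      have hf : ff ((c, xor (xor y.2 m.2) (eps q)) : Gp n) q = xor y.2 m.2 := by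
        unfold ff; simp
      have e1 : E ((c, xor (xor y.2 m.2) (eps q)) : Gp n) l y.1 = q := by
        rw [E_eq]; unfold J; rw [hf]; exact h2
      have e2 : E ((c, xor (xor y.2 m.2) (eps q)) : Gp n) i ((E (0, false) i).symm m.1) = q := by
        rw [E_eq]; unfold J; rw [hf]; exact h1
      rw [e1, e2, hf]
      refine ⟨rfl, ?_⟩
      cases y.2 <;> simp
  exact ⟨_, (key _).2 rfl, fun k hk => (key k).1 hk⟩

/-- Majority. -/
def maj (x y z : Bool) : Bool := (x && y) || (x && z) || (y && z)

theorem tr_iff (x y z k : Gp n) :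
    ((CC k 0 x).1 = (CC k 1 y).1 ∧ (CC k 0 x).1 = (CC k 2 z).1 ∧
    ¬ ((CC k 0 x).2 = true ∧ (CC k 1 y).2 = true) ∧
    ¬ ((CC k 0 x).2 = true ∧ (CC k 2 z).2 = true) ∧
    ¬ ((CC k 1 y).2 = true ∧ (CC k 2 z).2 = true)) ↔
    (k = (y.1 - x.1, xor (maj x.2 y.2 z.2) (eps x.1)) ∧
      x.1 + y.1 + z.1 + bc (maj x.2 y.2 z.2) = 0) := by
  have hbool : ∀ f a b c : Bool, (¬ (xor a f = true ∧ xor b f = true) ∧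
      ¬ (xor a f = true ∧ xor c f = true) ∧ ¬ (xor b f = true ∧ xor c f = true)) ↔
      f = maj a b c := by decide
  have e0 : E k 0 x.1 = x.1 := by rw [E_eq]; rfl
  unfold CC
  simp only [e0]
  constructor
  · rintro ⟨h1, h2, h3⟩
    rw [← h1, ← h2, hbool] at h3
    have g1 := E_eq.1 h1.symm
    have g2 := E_eq.1 h2.symm
    unfold J at g1 g2
    rw [h3] at g1 g2
    simp only [J0] at g1 g2
    rw [← h3] at g2 ⊢
    refine ⟨Prod.ext ?_ ?_, ?_⟩
    · simp only; rw [g1]; ring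
    · simp only; unfold ff; cases k.2 <;> simp
    · rw [g1, g2]; ring
  · rintro ⟨hk, hs⟩
    have hf : ff k x.1 = maj x.2 y.2 z.2 := by rw [hk]; unfold ff; simp
    have h1 : E k 1 y.1 = x.1 := by
      rw [E_eq]; unfold J; rw [hk]; simp only [J0]; ring
    have h2 : E k 2 z.1 = x.1 := by
      rw [E_eq]; unfold J; rw [hf, hk]; simp only [J0]; linear_combination hs
    rw [h1, h2, hbool]
    exact ⟨rfl, rfl, hf⟩

theorem sum_iff (x y z : Gp n) : x.1 + y.1 + z.1 + bc (maj x.2 y.2 z.2) = 0 ↔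
    (Th x + Th y + Th z = 0 ∨ Th x + Th y + Th z = 1) := by
  have hn : 0 < n := Nat.pos_of_ne_zero (NeZero.ne n)
  obtain ⟨r, hr, hb⟩ : ∃ r, r ≤ 1 ∧ x.2.toNat + y.2.toNat + z.2.toNat =
      2 * (maj x.2 y.2 z.2).toNat + r := by
    refine ⟨x.2.toNat + y.2.toNat + z.2.toNat - 2 * (maj x.2 y.2 z.2).toNat, ?_⟩
    cases x.2 <;> cases y.2 <;> cases z.2 <;> simp [maj]
  obtain ⟨T, hT⟩ : ∃ T, T = x.1.val + y.1.val + z.1.val + (maj x.2 y.2 z.2).toNat := ⟨_, rfl⟩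
  have e1 : x.1 + y.1 + z.1 + bc (maj x.2 y.2 z.2) = ((T : ℕ) : ZMod n) := by
    rw [hT]; push_cast
    rw [ZMod.natCast_zmod_val, ZMod.natCast_zmod_val, ZMod.natCast_zmod_val]
    rfl
  have e2 : Th x + Th y + Th z = ((2 * T + r : ℕ) : ZMod (2 * n)) := by
    unfold Th
    rw [← Nat.cast_add, ← Nat.cast_add]
    congr 1
    omega
  rw [e1, e2, ZMod.natCast_eq_zero_iff]
  constructor
  · rintro ⟨k, rfl⟩
    have : ((2 * (n * k) + r : ℕ) : ZMod (2 * n)) = ((r : ℕ) : ZMod (2 * n)) := by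
      have h : (2 : ZMod (2 * n)) * (n : ZMod (2 * n)) = 0 := two_n_zero
      push_cast
      linear_combination (k : ZMod (2 * n)) * h
    rw [this]
    have : r = 0 ∨ r = 1 := by omega
    rcases this with rfl | rfl
    · left; simp
    · right; simp
  · rintro (h | h)
    · rw [ZMod.natCast_eq_zero_iff] at h
      obtain ⟨k, hk⟩ := h
      rw [mul_assoc] at hk
      exact ⟨k, by omega⟩
    · have h' : ((2 * T + r : ℕ) : ZMod (2 * n)) = ((1 : ℕ) : ZMod (2 * n)) := by
        rw [h]; simp
      rw [ZMod.natCast_eq_natCast_iff'] at h'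
      rw [Nat.mod_eq_of_lt (by omega : 1 < 2 * n)] at h'
      have := Nat.div_add_mod (2 * T + r) (2 * n)
      rw [h', mul_assoc] at this
      exact ⟨(2 * T + r) / (2 * n), by omega⟩

/-- The concrete system. -/
noncomputable def theSys (n : ℕ) [NeZero n] : Sys n where
  C := CC
  t := tt
  M := Mul
  Θ := Th
  k0 := (0, false)
  C_bij := CC_bij
  t_bij := tt_bij
  M_comm a b := by unfold Mul; rw [add_comm]
  M_bij := Mul_bij
  M_diag := Mul_diag
  t_diag k i a := by
    rw [Mul_diag]
    unfold tt CC
    simp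
  exu := CC_exu
  t0 i m := by
    unfold tt
    simp
  Θ_bij := Th_bij
  tr1 x y z h := by
    refine ⟨_, (tr_iff x y z _).2 ⟨rfl, (sum_iff x y z).2 h⟩, ?_⟩
    intro k hk
    exact ((tr_iff x y z k).1 hk).1
  tr2 x y z k h1 h2 h3 h4 h5 :=
    (sum_iff x y z).1 ((tr_iff x y z k).1 ⟨h1, h2, h3, h4, h5⟩).2
  hex Q := ⟨hrel Q, fun _ _ h => hrel_symm h, fun _ _ h => hrel_mul h, hrel_iff Q⟩

end Concrete

/-- existence of PICS_2^e((2n)^3 : 0). -/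
theorem stmt_13 (n e : ℕ) (hn : 0 < n) (he : e ≤ 3 * n) (he3 : e % 3 = 0) :
    ∃ (G : Fin 3 → Finset (Fin (6 * n)))
      (A : Multiset (Finset (Fin (6 * n)))),
      IsPICS2 n e G A := by
  have : NeZero n := ⟨by omega⟩
  exact (theSys n).exists_pics e he he3

end DataPlacement
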